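/- arXiv:2011.00131 — 4 statements merged into one kernel-verified Lean document; each statement's English description precedes it below -/
import Mathlib

section
/- Let V be a finite set with a metric cost function c, let R ⊆ V, and let u and v be distinct elements of R. If W is a walk in the complete graph on V from u to v that visits every vertex of R, then there exists a Hamiltonian path on R from u to v whose cost is at most the cost of W. -/
/-- The cost of a path given as a list of vertices: the sum of the costs of
its consecutive pairs. -/
def listCost {α : Type*} (c : α → α → ℝ) : List α → ℝ
  | [] => 0
  | [_] => 0
  | a :: b :: l => c a b + listCost c (b :: l)

theorem listCost_cons_le_add {α : Type*} (c : α → α → ℝ) (hnn : ∀ u v, 0 ≤ c u v)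
    (htri : ∀ u v w, c u w ≤ c u v + c v w) (a b : α) (l : List α) :
    listCost c (a :: l) ≤ c a b + listCost c (b :: l) := by
  cases l with
  | nil => simpa [listCost] using hnn a b
  | cons x l =>
    simp only [listCost]
    linarith [htri a b x]

theorem listCost_cons_le_of_sublist {α : Type*} (c : α → α → ℝ) (hnn : ∀ u v, 0 ≤ c u v)
    (htri : ∀ u v w, c u w ≤ c u v + c v w) {l₁ l₂ : List α} (h : l₁.Sublist l₂) (a : α) :
    listCost c (a :: l₁) ≤ listCost c (a :: l₂) := by
  induction h generalizing a with
  | slnil => exact le_rfl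
  | cons b _ ih =>
    exact (listCost_cons_le_add c hnn htri a b _).trans (add_le_add_right (ih b) (c a b))
  | cons_cons b _ ih => exact add_le_add_right (ih b) (c a b)

theorem SimpleGraph.Walk.exists_support_eq_cons_append {V : Type*} {G : SimpleGraph V} {u v : V}
    (huv : u ≠ v) (W : G.Walk u v) : ∃ m : List V, W.support = u :: (m ++ [v]) := by
  cases W with
  | nil => exact absurd rfl huv
  | cons h p =>
    refine ⟨p.support.dropLast, ?_⟩
    rw [SimpleGraph.Walk.support_cons]
    congr 1
    conv_lhs => rw [← List.dropLast_append_getLast p.support_ne_nil, p.getLast_support]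

/-- Shortcutting: any walk in the complete graph on `V` from `u` to `v`
visiting all vertices of `R` can be turned into a Hamiltonian path on `R`
from `u` to `v` of no larger cost, for a metric cost function. -/
theorem ham_path_of_walk {V : Type*} [Fintype V] [DecidableEq V]
    (c : V → V → ℝ)
    (hnn : ∀ u v, 0 ≤ c u v) (hsymm : ∀ u v, c u v = c v u)
    (hrefl : ∀ v, c v v = 0) (htri : ∀ u v w, c u w ≤ c u v + c v w)
    (R : Finset V) (u v : V) (hu : u ∈ R) (hv : v ∈ R) (huv : u ≠ v)
    (W : (⊤ : SimpleGraph V).Walk u v) (hW : ∀ r ∈ R, r ∈ W.support) :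
    ∃ l : List V, l.Nodup ∧ (∀ x, x ∈ l ↔ x ∈ R) ∧
      l.head? = some u ∧ l.getLast? = some v ∧
      listCost c l ≤ listCost c W.support := by
  obtain ⟨m, hm⟩ := W.exists_support_eq_cons_append huv
  rw [hm] at hW ⊢
  set d := (m.filter (fun x => x ∈ R ∧ x ≠ u ∧ x ≠ v)).dedup with hd
  have hmem : ∀ x, x ∈ d ↔ x ∈ m ∧ x ∈ R ∧ x ≠ u ∧ x ≠ v := by simp [hd]
  refine ⟨u :: (d ++ [v]), ?_, fun x => ?_, rfl, ?_, ?_⟩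
  · have hnd : d.Nodup := List.nodup_dedup _
    have hdu : u ∉ d := by simp [hmem]
    have hdv : v ∉ d := by simp [hmem]
    rw [List.nodup_cons, List.nodup_append]
    grind
  · have := hW x
    simp only [List.mem_cons, List.mem_append, List.not_mem_nil, or_false, hmem] at this ⊢
    grind
  · rw [← List.cons_append, List.getLast?_concat]
  · exact listCost_cons_le_of_sublist c hnn htri
      (((List.dedup_sublist _).trans List.filter_sublist).append_right [v]) u
end

section
/- (Lemma 4) Let V be a finite set with a metric cost function c, with |V| ≥ 2, let T be a tree whose vertex set is V, and let u and v be distinct elements of V. Then there exists a Hamiltonian path on V from u to v whose cost is at most 2·c(T). -/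
open scoped Classical

/-- The cost of a simple graph: the sum of the costs of its edges (for a
symmetric cost function, each unordered edge is counted once). -/
noncomputable def graphCost {α : Type*} [Fintype α] (c : α → α → ℝ) (G : SimpleGraph α) : ℝ :=
  (∑ x : α, ∑ y : α, if G.Adj x y then c x y else 0) / 2

section

variable {V : Type*} {c : V → V → ℝ}

theorem listCost_append_cons (c : V → V → ℝ) (p q : List V) (a : V) :
    listCost c (p ++ a :: q) = listCost c (p ++ [a]) + listCost c (a :: q) := by
  induction p with
  | nil => simp [listCost]
  | cons b p ih =>
    cases p with
    | nil => simp [listCost]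
    | cons d p => simp only [List.cons_append, listCost] at ih ⊢; rw [ih]; ring

theorem listCost_append_cons_cons (c : V → V → ℝ) (p q : List V) (a b : V) :
    listCost c (p ++ a :: b :: q) = listCost c (p ++ [a]) + c a b + listCost c (b :: q) := by
  rw [listCost_append_cons, listCost, add_assoc]

theorem listCost_reverse (hsymm : ∀ u v, c u v = c v u) (l : List V) :
    listCost c l.reverse = listCost c l := by
  induction l with
  | nil => rfl
  | cons a l ih =>
    cases l with
    | nil => rfl
    | cons b l =>
      simp only [List.reverse_cons, List.append_assoc, List.cons_append, List.nil_append] at ih ⊢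
      rw [listCost_append_cons_cons, ih, listCost, listCost, hsymm b a]
      ring

/-- `l` lists each element of `A` exactly once, starting at `u` and ending at `w`. -/
structure IsHamPathOn (A : Finset V) (l : List V) (u w : V) : Prop where
  nodup : l.Nodup
  mem_iff : ∀ z, z ∈ l ↔ z ∈ A
  head : l.head? = some u
  last : l.getLast? = some w

theorem IsHamPathOn.reverse {A : Finset V} {l : List V} {u w : V} (h : IsHamPathOn A l u w) :
    IsHamPathOn A l.reverse w u :=
  ⟨List.nodup_reverse.2 h.nodup, fun z => List.mem_reverse.trans (h.mem_iff z),
    by simpa using h.last, by simpa using h.head⟩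

theorem IsHamPathOn.of_perm {A : Finset V} {l l' : List V} {u w u' w' x : V}
    (h : IsHamPathOn A l u w) (hx : x ∉ A) (hp : l'.Perm (x :: l))
    (hu : l'.head? = some u') (hw : l'.getLast? = some w') :
    IsHamPathOn (insert x A) l' u' w' :=
  ⟨hp.nodup_iff.2 (List.nodup_cons.2 ⟨fun hl => hx ((h.mem_iff x).1 hl), h.nodup⟩),
    fun z => by rw [hp.mem_iff, List.mem_cons, Finset.mem_insert, h.mem_iff], hu, hw⟩

/-- Any `u, v ∈ A` are joined by a Hamiltonian path on `A` of cost at most `r - c u v`; when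
`u = v`, the path instead ends at some `w` and the cost includes that of returning to `v`. -/
def HasHamPaths (c : V → V → ℝ) (A : Finset V) (r : ℝ) : Prop :=
  ∀ u ∈ A, ∀ v ∈ A, ∃ l w, IsHamPathOn A l u w ∧ (u ≠ v → w = v) ∧
    listCost c l + c w v + c u v ≤ r

theorem hasHamPaths_singleton (hrefl : ∀ v, c v v = 0) (a : V) : HasHamPaths c {a} 0 := by
  intro u hu v hv
  obtain rfl := Finset.mem_singleton.1 hu
  obtain rfl := Finset.mem_singleton.1 hv
  exact ⟨[v], v, ⟨by simp, by simp, rfl, rfl⟩, fun _ => rfl, by simp [listCost, hrefl]⟩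

theorem HasHamPaths.mono {A : Finset V} {r s : ℝ} (h : HasHamPaths c A r) (hrs : r ≤ s) :
    HasHamPaths c A s := fun u hu v hv =>
  let ⟨l, w, hl, hw, hc⟩ := h u hu v hv
  ⟨l, w, hl, hw, hc.trans hrs⟩

/-- Inserting a new vertex next to `y` into a Hamiltonian path whose endpoints lie in `A`. -/
theorem HasHamPaths.insert_of_mem {A : Finset V} {r : ℝ} {x y u v : V}
    (hsymm : ∀ u v, c u v = c v u) (htri : ∀ u v w, c u w ≤ c u v + c v w)
    (h : HasHamPaths c A r) (hx : x ∉ A) (hy : y ∈ A) (hu : u ∈ A) (hv : v ∈ A) :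
    ∃ l w, IsHamPathOn (insert x A) l u w ∧ (u ≠ v → w = v) ∧
      listCost c l + c w v + c u v ≤ r + 2 * c x y := by
  obtain ⟨l, w, hl, hw, hc⟩ := h u hu v hv
  obtain ⟨p, q, rfl⟩ := List.append_of_mem ((hl.mem_iff y).2 hy)
  have hhead := hl.head
  have hlast := hl.last
  have hxy := hsymm y x
  rcases q with _ | ⟨z, q⟩
  · obtain rfl : y = w := by simpa using hlast
    by_cases huv : u = v
    · refine ⟨(p ++ [y]) ++ [x], x, hl.of_perm hx List.perm_append_comm ?_ (by simp),
        fun hne => absurd huv hne, ?_⟩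
      · rw [List.head?_append, hhead]; rfl
      · have := htri x y v
        rw [List.append_assoc, List.singleton_append, listCost_append_cons_cons, listCost]
        linarith
    · obtain rfl := hw huv
      rcases List.eq_nil_or_concat p with rfl | ⟨p, t, rfl⟩
      · exact absurd (by simpa using hhead.symm) huv
      · refine ⟨(p ++ [t]) ++ [x, y], y, hl.of_perm hx ?_ ?_ (by simp), fun _ => rfl, ?_⟩
        · simpa using List.perm_middle (l₁ := p ++ [t]) (l₂ := [y]) (a := x)
        · simpa [List.head?_append] using hhead
        · have := htri t y x
          simp only [List.concat_eq_append, List.append_assoc, List.singleton_append,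
            listCost_append_cons_cons, listCost] at hc ⊢
          linarith
  · refine ⟨p ++ y :: x :: z :: q, w, hl.of_perm hx ?_ ?_ ?_, hw, ?_⟩
    · simpa using List.perm_middle (l₁ := p ++ [y]) (l₂ := z :: q) (a := x)
    · simpa [List.head?_append] using hhead
    · simpa using hlast
    · have := htri x y z
      simp only [listCost_append_cons_cons, listCost] at hc ⊢
      linarith

/-- A Hamiltonian path on `A` extends to one ending at a new vertex attached to `y`. -/
theorem HasHamPaths.insert_last {A : Finset V} {r : ℝ} {x y u : V}
    (hsymm : ∀ u v, c u v = c v u) (htri : ∀ u v w, c u w ≤ c u v + c v w)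
    (h : HasHamPaths c A r) (hx : x ∉ A) (hy : y ∈ A) (hu : u ∈ A) :
    ∃ l, IsHamPathOn (insert x A) l u x ∧ listCost c l + c u x ≤ r + 2 * c x y := by
  obtain ⟨l, w, hl, -, hc⟩ := h u hu y hy
  obtain ⟨p, rfl⟩ : ∃ p, l = p ++ [w] := List.getLast?_eq_some_iff.1 hl.last
  refine ⟨(p ++ [w]) ++ [x], hl.of_perm hx List.perm_append_comm ?_ (by simp), ?_⟩
  · rw [List.head?_append, hl.head]; rfl
  · have h₁ := htri w y x
    have h₂ := htri u y x
    have h₃ := hsymm y x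
    rw [List.append_assoc, List.singleton_append, listCost_append_cons_cons, listCost]
    linarith

theorem HasHamPaths.insert {A : Finset V} {r : ℝ} {x y : V}
    (hsymm : ∀ u v, c u v = c v u) (hrefl : ∀ v, c v v = 0)
    (htri : ∀ u v w, c u w ≤ c u v + c v w)
    (h : HasHamPaths c A r) (hx : x ∉ A) (hy : y ∈ A) :
    HasHamPaths c (insert x A) (r + 2 * c x y) := by
  intro u hu v hv
  rcases Finset.mem_insert.1 hu with rfl | hu' <;>
    rcases Finset.mem_insert.1 hv with rfl | hv'
  · obtain ⟨l, w, hl, -, hc⟩ := h y hy y hy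
    obtain ⟨q, rfl⟩ : ∃ q, l = y :: q := List.head?_eq_some_iff.1 hl.head
    refine ⟨v :: y :: q, w, hl.of_perm hx (.refl _) rfl (by simpa using hl.last),
      fun hne => absurd rfl hne, ?_⟩
    have h₁ := htri w y v
    have h₂ := hsymm y v
    rw [listCost, hrefl]
    rw [hrefl] at hc
    linarith
  · obtain ⟨l, hl, hc⟩ := h.insert_last hsymm htri hx hy hv'
    refine ⟨l.reverse, v, hl.reverse, fun _ => rfl, ?_⟩
    rw [listCost_reverse hsymm, hrefl, hsymm u v]
    linarith
  · obtain ⟨l, hl, hc⟩ := h.insert_last hsymm htri hx hy hu'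
    exact ⟨l, v, hl, fun _ => rfl, by rw [hrefl]; linarith⟩
  · exact h.insert_of_mem hsymm htri hx hy hu' hv'

theorem sum_adj_insert_ge (hnn : ∀ u v, 0 ≤ c u v) (hsymm : ∀ u v, c u v = c v u)
    (G : SimpleGraph V) {A : Finset V} {x y : V} (hx : x ∉ A) (hy : y ∈ A) (hxy : G.Adj x y) :
    (∑ a ∈ A, ∑ b ∈ A, if G.Adj a b then c a b else 0) + 2 * c x y ≤
      ∑ a ∈ insert x A, ∑ b ∈ insert x A, if G.Adj a b then c a b else 0 := by
  have hterm : ∀ a b, 0 ≤ if G.Adj a b then c a b else 0 := fun a b => by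
    split_ifs
    exacts [hnn a b, le_rfl]
  have h₁ : c x y ≤ ∑ b ∈ A, if G.Adj x b then c x b else 0 := by
    simpa [hxy] using Finset.single_le_sum (f := fun b => if G.Adj x b then c x b else 0)
      (fun b _ => hterm x b) hy
  have h₂ : c x y ≤ ∑ a ∈ A, if G.Adj a x then c a x else 0 := by
    simpa [hxy.symm, hsymm y x] using
      Finset.single_le_sum (f := fun a => if G.Adj a x then c a x else 0)
        (fun a _ => hterm a x) hy
  simp only [Finset.sum_insert hx, Finset.sum_add_distrib]
  linarith [hterm x x]

theorem SimpleGraph.Connected.hasHamPaths_univ [Fintype V] {G : SimpleGraph V}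
    (hG : G.Connected) (hnn : ∀ u v, 0 ≤ c u v) (hsymm : ∀ u v, c u v = c v u)
    (hrefl : ∀ v, c v v = 0) (htri : ∀ u v w, c u w ≤ c u v + c v w) :
    HasHamPaths c Finset.univ (2 * graphCost c G) := by
  let S : Set (Finset V) := {A | A.Nonempty ∧
    HasHamPaths c A (∑ a ∈ A, ∑ b ∈ A, if G.Adj a b then c a b else 0)}
  obtain ⟨a⟩ := hG.nonempty
  have hS : S.Nonempty :=
    ⟨{a}, Finset.singleton_nonempty a, by simpa using hasHamPaths_singleton hrefl a⟩
  obtain ⟨A, ⟨⟨y, hy⟩, hA⟩, hmax⟩ := S.toFinite.exists_maximal hS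
  have huniv : A = Finset.univ := by
    by_contra hne
    obtain ⟨z, hz⟩ : ∃ z, z ∉ A := by simpa [Finset.eq_univ_iff_forall] using hne
    obtain ⟨p⟩ := hG.preconnected y z
    obtain ⟨d, -, hd₁, hd₂⟩ := p.exists_boundary_dart (A : Set V) hy hz
    have hins : insert d.snd A ∈ S := ⟨Finset.insert_nonempty _ _,
      (hA.insert hsymm hrefl htri hd₂ hd₁).mono (sum_adj_insert_ge hnn hsymm G hd₂ hd₁ d.adj.symm)⟩
    exact hd₂ (hmax hins (Finset.subset_insert _ _) (Finset.mem_insert_self _ _))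
  subst huniv
  refine hA.mono (le_of_eq ?_)
  rw [graphCost]
  ring

end

/-- Lemma 4: for a tree `T` spanning a finite metric space `V` with at least
two points, and any two distinct vertices `u, v`, there is a Hamiltonian path
on `V` from `u` to `v` of cost at most `2 · c(T)`. -/
theorem ham_path_of_tree {V : Type*} [Fintype V] [DecidableEq V]
    (h2 : 2 ≤ Fintype.card V)
    (c : V → V → ℝ)
    (hnn : ∀ u v, 0 ≤ c u v) (hsymm : ∀ u v, c u v = c v u)
    (hrefl : ∀ v, c v v = 0) (htri : ∀ u v w, c u w ≤ c u v + c v w)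
    (T : SimpleGraph V) (hT : T.IsTree)
    (u v : V) (huv : u ≠ v) :
    ∃ l : List V, l.Nodup ∧ (∀ x : V, x ∈ l) ∧
      l.head? = some u ∧ l.getLast? = some v ∧
      listCost c l ≤ 2 * graphCost c T := by
  obtain ⟨l, w, hl, hw, hc⟩ := hT.1.hasHamPaths_univ hnn hsymm hrefl htri u (Finset.mem_univ u)
    v (Finset.mem_univ v)
  obtain rfl := hw huv
  exact ⟨l, hl.nodup, fun x => (hl.mem_iff x).2 (Finset.mem_univ x), hl.head, hl.last,
    by linarith [hnn w w, hnn u w]⟩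
end

section
/- (Lemma 3, contracted form) Let V be a finite set with a metric cost function c, let R ⊂ V be partitioned into nonempty pairwise disjoint clusters R₁, …, R_k. Then in the contracted graph G/R, the minimum cost of a Steiner tree for the terminal set {r₁, …, r_k} is at most the minimum cost of a clustered Steiner tree for R₁, …, R_k in the complete graph on V. -/
open scoped Classical

/-- A clustered Steiner tree for the clusters `P 0, …, P (k-1)`: a tree `tree`
on a vertex set `verts ⊆ V` containing all clusters, whose vertex set is
partitioned into parts `part i ⊇ P i`, each inducing a connected subgraph
(the local trees).  Cutting the `k - 1` inter-part edges yields the `k`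
local subtrees, each spanning its cluster. -/
structure ClusteredSteinerTree {V : Type*} [Fintype V] {k : ℕ} (P : Fin k → Finset V) where
  verts : Finset V
  tree : SimpleGraph {x : V // x ∈ verts}
  isTree : tree.IsTree
  part : Fin k → Finset V
  part_subset : ∀ i, part i ⊆ verts
  cluster_subset : ∀ i, P i ⊆ part i
  part_cover : ∀ x ∈ verts, ∃ i, x ∈ part i
  part_disjoint : ∀ i j, i ≠ j → Disjoint (part i) (part j)
  part_connected : ∀ i, (tree.induce {x : {x : V // x ∈ verts} | x.1 ∈ part i}).Connected

/-- The cost of a clustered Steiner tree: the sum of the costs of all of its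
edges. -/
noncomputable def ClusteredSteinerTree.cost {V : Type*} [Fintype V] {k : ℕ}
    {P : Fin k → Finset V} (T : ClusteredSteinerTree P) (c : V → V → ℝ) : ℝ :=
  graphCost (fun a b => c a.1 b.1) T.tree

/-- The minimum cost of a Steiner tree for the terminal set `X` in the
complete graph on `W`. -/
noncomputable def steinerCost {W : Type*} [Fintype W] (c : W → W → ℝ) (X : Finset W) : ℝ :=
  sInf {x : ℝ | ∃ (S : Finset W) (T : SimpleGraph {w : W // w ∈ S}),
    X ⊆ S ∧ T.IsTree ∧ graphCost (fun a b => c a.1 b.1) T = x}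

/-- The cost function on the contracted graph `G/R`: each cluster `P i` is
contracted to the single vertex `Sum.inr i`, the cost between a contracted
vertex and another vertex being the minimum cost over the cluster. -/
noncomputable def contractedCost {V : Type*} {k : ℕ} (c : V → V → ℝ) (P : Fin k → Finset V) :
    ({x : V // ∀ i, x ∉ P i} ⊕ Fin k) → ({x : V // ∀ i, x ∉ P i} ⊕ Fin k) → ℝ
  | Sum.inl x, Sum.inl y => c x.1 y.1
  | Sum.inl x, Sum.inr i => sInf ((fun u => c u x.1) '' (P i : Set V))
  | Sum.inr i, Sum.inl x => sInf ((fun u => c u x.1) '' (P i : Set V))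
  | Sum.inr i, Sum.inr j =>
      if i = j then 0
      else sInf ((fun p : V × V => c p.1 p.2) '' ((P i : Set V) ×ˢ (P j : Set V)))

theorem graphCost_nonneg {α : Type*} [Fintype α] {c : α → α → ℝ} (hc : ∀ x y, 0 ≤ c x y)
    (G : SimpleGraph α) : 0 ≤ graphCost c G := by
  unfold graphCost
  refine div_nonneg (Finset.sum_nonneg fun x _ => Finset.sum_nonneg fun y _ => ?_) zero_le_two
  split_ifs
  exacts [hc x y, le_rfl]

theorem graphCost_eq_sum_filter {α : Type*} [Fintype α] (c : α → α → ℝ) (G : SimpleGraph α) :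
    graphCost c G =
      (∑ q ∈ Finset.univ.filter (fun q : α × α => G.Adj q.1 q.2), c q.1 q.2) / 2 := by
  rw [graphCost, Finset.sum_filter, Fintype.sum_prod_type]

/-- A subgraph of the image of `G` under a cost-nonincreasing map costs at most as much as `G`. -/
theorem graphCost_le_of_le_map {α β : Type*} [Fintype α] [Fintype β] {c : α → α → ℝ}
    {d : β → β → ℝ} (hc : ∀ x y, 0 ≤ c x y) (f : α → β) (hd : ∀ x y, d (f x) (f y) ≤ c x y)
    {G : SimpleGraph α} {H : SimpleGraph β} (hH : H ≤ G.map f) :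
    graphCost d H ≤ graphCost c G := by
  rw [graphCost_eq_sum_filter, graphCost_eq_sum_filter]
  refine div_le_div_of_nonneg_right ?_ zero_le_two
  have hsurj : Set.SurjOn (fun s : α × α => (f s.1, f s.2)) {s | G.Adj s.1 s.2}
      (Finset.univ.filter fun q : β × β => H.Adj q.1 q.2 : Finset (β × β)) := by
    intro q hq
    obtain ⟨-, x, y, hxy, hx, hy⟩ := hH (Finset.mem_filter.1 (Finset.mem_coe.1 hq)).2
    exact ⟨(x, y), hxy, Prod.ext hx hy⟩
  obtain ⟨u, hu, hinj, himg⟩ := Finset.exists_subset_injOn_image_eq_of_surjOn _ _ hsurj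
  rw [← himg, Finset.sum_image hinj]
  exact (Finset.sum_le_sum fun s _ => hd s.1 s.2).trans
    (Finset.sum_le_sum_of_subset_of_nonneg (fun s hs => by simpa using hu hs) fun s _ _ => hc s.1 s.2)

theorem SimpleGraph.Connected.map_of_surjective {α β : Type*} {G : SimpleGraph α}
    (hG : G.Connected) {f : α → β} (hf : Function.Surjective f) : (G.map f).Connected := by
  have key : ∀ x y, G.Reachable x y → (G.map f).Reachable (f x) (f y) := by
    rintro x y ⟨w⟩
    induction w with
    | nil => exact .rfl
    | @cons a b _ hab _ ih =>
      by_cases h : f a = f b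
      · rwa [h]
      · have hadj : (G.map f).Adj (f a) (f b) := ⟨h, a, b, hab, rfl, rfl⟩
        exact hadj.reachable.trans ih
  have := hG.nonempty
  refine (SimpleGraph.connected_iff _).2 ⟨fun a b => ?_, this.map f⟩
  obtain ⟨x, rfl⟩ := hf a
  obtain ⟨y, rfl⟩ := hf b
  exact key x y (hG.preconnected x y)

/-- A connected graph given by a parent function with a fixed root is a tree. -/
theorem SimpleGraph.isTree_fromRel_parent {α : Type*} [Finite α] {p : α → α} {root : α}
    (hroot : p root = root) (hconn : (SimpleGraph.fromRel fun x y => y = p x).Connected) :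
    (SimpleGraph.fromRel fun x y => y = p x).IsTree := by
  have := Fintype.ofFinite α
  refine SimpleGraph.isTree_iff_connected_and_card.2
    ⟨hconn, le_antisymm ?_ hconn.card_vert_le_card_edgeSet_add_one⟩
  have hsub : (SimpleGraph.fromRel fun x y => y = p x).edgeSet ⊆
      ((Finset.univ.erase root).image fun x => s(x, p x) : Finset (Sym2 α)) := by
    intro e
    induction e with
    | _ x y =>
      rw [SimpleGraph.mem_edgeSet, SimpleGraph.fromRel_adj]
      rintro ⟨hne, h | h⟩
      · refine Finset.mem_coe.2 (Finset.mem_image.2 ⟨x, ?_, by rw [h]⟩)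
        simp only [Finset.mem_erase, Finset.mem_univ, and_true]
        rintro rfl
        exact hne (h.trans hroot).symm
      · refine Finset.mem_coe.2 (Finset.mem_image.2 ⟨y, ?_, by rw [h, Sym2.eq_swap]⟩)
        simp only [Finset.mem_erase, Finset.mem_univ, and_true]
        rintro rfl
        exact hne (h.trans hroot)
  have h1 := Set.ncard_le_ncard hsub (Finset.finite_toSet _)
  rw [Set.ncard_coe_finset] at h1
  have h2 : ((Finset.univ.erase root).image fun x => s(x, p x)).card ≤ Fintype.card α - 1 :=
    Finset.card_image_le.trans (by simp [Finset.card_erase_of_mem])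
  have h3 : 0 < Fintype.card α := Fintype.card_pos_iff.2 ⟨root⟩
  rw [Nat.card_eq_fintype_card (α := α), Nat.card_coe_set_eq]
  omega

/-- Stars inside the clusters, joined by a star on the cluster representatives. -/
theorem ClusteredSteinerTree.nonempty {V : Type*} [Fintype V] {k : ℕ} [NeZero k]
    {P : Fin k → Finset V} (hne : ∀ i, (P i).Nonempty)
    (hdisj : ∀ i j, i ≠ j → Disjoint (P i) (P j)) : Nonempty (ClusteredSteinerTree P) := by
  have hsub : ∀ i, P i ⊆ Finset.univ.biUnion P := fun i =>
    Finset.subset_biUnion_of_mem P (Finset.mem_univ i)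
  have hcov : ∀ x ∈ Finset.univ.biUnion P, ∃ i, x ∈ P i := by simp
  have huniq : ∀ {x i j}, x ∈ P i → x ∈ P j → i = j := fun {x i j} hi hj => by
    by_contra h
    exact Finset.disjoint_left.1 (hdisj i j h) hi hj
  choose idx hidx using fun x : {x // x ∈ Finset.univ.biUnion P} => hcov x.1 x.2
  choose r hr using hne
  let rep : Fin k → {x // x ∈ Finset.univ.biUnion P} := fun i => ⟨r i, hsub i (hr i)⟩
  have hrep : ∀ i, idx (rep i) = i := fun i => huniq (hidx (rep i)) (hr i)
  let p : {x // x ∈ Finset.univ.biUnion P} → {x // x ∈ Finset.univ.biUnion P} :=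
    fun x => if x = rep (idx x) then rep 0 else rep (idx x)
  have hp_rep : ∀ i, p (rep i) = rep 0 := fun i => by simp [p, hrep]
  have hp : ∀ x, x ≠ rep (idx x) → p x = rep (idx x) := fun x hx => if_neg hx
  let G := SimpleGraph.fromRel fun x y => y = p x
  have hadj : ∀ x, x ≠ rep (idx x) → G.Adj (rep (idx x)) x := fun x hx =>
    (SimpleGraph.fromRel_adj _ _ _).2 ⟨hx.symm, .inr (hp x hx).symm⟩
  have hroot : ∀ i, G.Reachable (rep 0) (rep i) := fun i => by
    by_cases h : rep 0 = rep i
    · rw [h]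
    · exact SimpleGraph.Adj.reachable
        ((SimpleGraph.fromRel_adj _ _ _).2 ⟨h, .inr (hp_rep i).symm⟩)
  have hconn : G.Connected := SimpleGraph.connected_iff_exists_forall_reachable _ |>.2
    ⟨rep 0, fun x => by
      by_cases h : x = rep (idx x)
      · rw [h]
        exact hroot _
      · exact (hroot _).trans (hadj x h).reachable⟩
  refine ⟨⟨Finset.univ.biUnion P, G, SimpleGraph.isTree_fromRel_parent (hp_rep 0) hconn,
    P, hsub, fun i => subset_rfl, hcov, hdisj, fun i => ?_⟩⟩
  refine SimpleGraph.connected_iff_exists_forall_reachable _ |>.2 ⟨⟨rep i, hr i⟩, ?_⟩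
  rintro ⟨x, hx⟩
  have hxi : idx x = i := huniq (hidx x) hx
  subst hxi
  by_cases h : x = rep (idx x)
  · exact (Subtype.ext h.symm : (⟨rep (idx x), _⟩ : {y // y.1 ∈ P (idx x)}) = ⟨x, hx⟩) ▸ .rfl
  · exact SimpleGraph.Adj.reachable (SimpleGraph.comap_adj.2 (hadj x h))

theorem contractedCost_nonneg {V : Type*} {k : ℕ} {c : V → V → ℝ} (hnn : ∀ u v, 0 ≤ c u v)
    (P : Fin k → Finset V) (a b) : 0 ≤ contractedCost c P a b := by
  rcases a with x | i <;> rcases b with y | j <;> simp only [contractedCost]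
  · exact hnn _ _
  · exact Real.sInf_nonneg (by rintro _ ⟨u, -, rfl⟩; exact hnn _ _)
  · exact Real.sInf_nonneg (by rintro _ ⟨u, -, rfl⟩; exact hnn _ _)
  · split_ifs
    · exact le_rfl
    · exact Real.sInf_nonneg (by rintro _ ⟨u, -, rfl⟩; exact hnn _ _)

theorem steinerCost_le {W : Type*} [Fintype W] {c : W → W → ℝ} (hc : ∀ u v, 0 ≤ c u v)
    {X S : Finset W} {T : SimpleGraph {w : W // w ∈ S}} (hX : X ⊆ S) (hT : T.IsTree) :
    steinerCost c X ≤ graphCost (fun a b => c a.1 b.1) T := by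
  refine csInf_le ⟨0, ?_⟩ ⟨S, T, hX, hT, rfl⟩
  rintro _ ⟨S', T', -, -, rfl⟩
  exact graphCost_nonneg (fun a b => hc a.1 b.1) T'

/-- A Steiner tree for the image terminals is contained in the image of a connected graph. -/
theorem steinerCost_le_of_connected {V W : Type*} [Fintype V] [Fintype W] {c : V → V → ℝ}
    {d : W → W → ℝ} (hc : ∀ x y, 0 ≤ c x y) (hd : ∀ u v, 0 ≤ d u v) (φ : V → W)
    (hφ : ∀ x y, d (φ x) (φ y) ≤ c x y) {A : Finset V} {G : SimpleGraph {x // x ∈ A}}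
    (hG : G.Connected) {X : Finset W} (hX : ∀ w ∈ X, ∃ x ∈ A, φ x = w) :
    steinerCost d X ≤ graphCost (fun a b => c a.1 b.1) G := by
  let f : {x // x ∈ A} → {w // w ∈ A.image φ} := fun x =>
    ⟨φ x.1, Finset.mem_image_of_mem _ x.2⟩
  have hf : Function.Surjective f := by
    rintro ⟨w, hw⟩
    obtain ⟨x, hx, rfl⟩ := Finset.mem_image.1 hw
    exact ⟨⟨x, hx⟩, rfl⟩
  obtain ⟨H, hH, hHtree⟩ := (hG.map_of_surjective hf).exists_isTree_le
  exact (steinerCost_le hd (fun w hw => Finset.mem_image.2 (hX w hw)) hHtree).trans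
    (graphCost_le_of_le_map (fun x y => hc x.1 y.1) f (fun x y => hφ x.1 y.1) hH)

/-- The contraction map `V → G/R`, sending each vertex of a cluster `P i` to `Sum.inr i`. -/
noncomputable def contract {V : Type*} {k : ℕ} (P : Fin k → Finset V) (x : V) :
    {x : V // ∀ i, x ∉ P i} ⊕ Fin k :=
  if h : ∃ i, x ∈ P i then .inr h.choose else .inl ⟨x, not_exists.1 h⟩

theorem contract_of_mem {V : Type*} {k : ℕ} {P : Fin k → Finset V}
    (hdisj : ∀ i j, i ≠ j → Disjoint (P i) (P j)) {x : V} {i : Fin k} (hx : x ∈ P i) :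
    contract P x = .inr i := by
  have h : ∃ i, x ∈ P i := ⟨i, hx⟩
  rw [contract, dif_pos h]
  congr 1
  by_contra hne
  exact Finset.disjoint_left.1 (hdisj _ _ hne) h.choose_spec hx

theorem contract_of_forall_notMem {V : Type*} {k : ℕ} {P : Fin k → Finset V} {x : V}
    (hx : ∀ i, x ∉ P i) : contract P x = .inl ⟨x, hx⟩ :=
  dif_neg (not_exists.2 hx)

theorem contractedCost_contract_le {V : Type*} {k : ℕ} {c : V → V → ℝ}
    (hnn : ∀ u v, 0 ≤ c u v) (hsymm : ∀ u v, c u v = c v u) {P : Fin k → Finset V}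
    (hdisj : ∀ i j, i ≠ j → Disjoint (P i) (P j)) (x y : V) :
    contractedCost c P (contract P x) (contract P y) ≤ c x y := by
  have hbdd : ∀ {ι : Type _} (g : ι → V × V) (s : Set ι),
      BddBelow ((fun u => c (g u).1 (g u).2) '' s) := fun g s =>
    ⟨0, by rintro _ ⟨u, -, rfl⟩; exact hnn _ _⟩
  by_cases hx : ∃ i, x ∈ P i <;> by_cases hy : ∃ j, y ∈ P j
  · obtain ⟨i, hx⟩ := hx
    obtain ⟨j, hy⟩ := hy
    rw [contract_of_mem hdisj hx, contract_of_mem hdisj hy, contractedCost]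
    split_ifs
    · exact hnn x y
    · exact csInf_le (hbdd id _) ⟨(x, y), ⟨hx, hy⟩, rfl⟩
  · obtain ⟨i, hx⟩ := hx
    rw [contract_of_mem hdisj hx, contract_of_forall_notMem (not_exists.1 hy), contractedCost]
    exact csInf_le (hbdd (fun u => (u, y)) _) ⟨x, hx, rfl⟩
  · obtain ⟨j, hy⟩ := hy
    rw [contract_of_forall_notMem (not_exists.1 hx), contract_of_mem hdisj hy, contractedCost,
      hsymm x y]
    exact csInf_le (hbdd (fun u => (u, x)) _) ⟨y, hy, rfl⟩
  · rw [contract_of_forall_notMem (not_exists.1 hx), contract_of_forall_notMem (not_exists.1 hy),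
      contractedCost]

/-- Lemma 3 (contracted form): the minimum Steiner tree cost for the
contracted terminals `r 1, …, r k` in `G/R` is at most the minimum cost of a
clustered Steiner tree for the clusters `P 1, …, P k`. -/
theorem contracted_steiner_le_clustered {V : Type*} [Fintype V] [DecidableEq V]
    (c : V → V → ℝ)
    (hnn : ∀ u v, 0 ≤ c u v) (hsymm : ∀ u v, c u v = c v u)
    (hrefl : ∀ v, c v v = 0) (htri : ∀ u v w, c u w ≤ c u v + c v w)
    {k : ℕ} (P : Fin k → Finset V)
    (hne : ∀ i, (P i).Nonempty)
    (hdisj : ∀ i j, i ≠ j → Disjoint (P i) (P j))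
    (hproper : ∃ x : V, ∀ i, x ∉ P i) :
    steinerCost (contractedCost c P) (Finset.univ.image Sum.inr) ≤
      sInf {x : ℝ | ∃ T : ClusteredSteinerTree P, T.cost c = x} := by
  have hcn := contractedCost_nonneg hnn P
  rcases Nat.eq_zero_or_pos k with rfl | hk
  · have hempty : {x : ℝ | ∃ T : ClusteredSteinerTree P, T.cost c = x} = ∅ := by
      refine Set.eq_empty_of_forall_notMem ?_
      rintro _ ⟨T, -⟩
      obtain ⟨v⟩ := T.isTree.connected.nonempty
      exact (T.part_cover v.1 v.2).choose.elim0
    rw [hempty, Real.sInf_empty]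
    obtain ⟨x, hx⟩ := hproper
    have hT : (⊥ : SimpleGraph {w // w ∈ ({Sum.inl ⟨x, hx⟩} :
        Finset ({x : V // ∀ i, x ∉ P i} ⊕ Fin 0))}).IsTree := .of_subsingleton
    refine (steinerCost_le hcn (by simp) hT).trans (le_of_eq ?_)
    simp [graphCost]
  · have : NeZero k := ⟨hk.ne'⟩
    obtain ⟨T₀⟩ := ClusteredSteinerTree.nonempty hne hdisj
    refine le_csInf ⟨_, T₀, rfl⟩ ?_
    rintro _ ⟨T, rfl⟩
    refine steinerCost_le_of_connected hnn hcn (contract P)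
      (contractedCost_contract_le hnn hsymm hdisj) T.isTree.connected fun w hw => ?_
    obtain ⟨i, -, rfl⟩ := Finset.mem_image.1 hw
    obtain ⟨x, hx⟩ := hne i
    exact ⟨x, T.part_subset i (T.cluster_subset i hx), contract_of_mem hdisj hx⟩
end

section
/- (Theorem 1, performance guarantee) Let V be a finite set with a metric cost function c, let R ⊂ V be partitioned into nonempty pairwise disjoint clusters R₁, …, R_k, let R'_i ⊂ R_i be subsets with |R_i ∖ R'_i| ≥ 2 for every i, and let ρ ≥ 1 be a real number. Let T_opt be a clustered selected-internal Steiner tree of minimum cost for these data, and let S be any Steiner tree for the terminal set {r₁, …, r_k} in the contracted graph G/R whose cost is at most ρ times the minimum Steiner tree cost for {r₁, …, r_k} in G/R. Then there exists a clustered selected-internal Steiner tree 𝒯 with c(𝒯) ≤ Σ_{i=1}^{k} 2·mst(R_i) + c(S), and moreover c(𝒯) ≤ (ρ + 4)·c(T_opt). -/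
open scoped Classical

/-- A clustered Steiner tree is selected-internal for `P'` if every vertex of
`P' i` is an internal (non-leaf) vertex of the `i`-th local tree, i.e. it has
at least two distinct neighbours inside its part. -/
def ClusteredSteinerTree.SelectedInternal {V : Type*} [Fintype V] {k : ℕ}
    {P : Fin k → Finset V} (T : ClusteredSteinerTree P) (P' : Fin k → Finset V) : Prop :=
  ∀ i : Fin k, ∀ x ∈ P' i, ∃ (hx : x ∈ T.verts) (y z : {v : V // v ∈ T.verts}),
    y.1 ∈ T.part i ∧ z.1 ∈ T.part i ∧ y ≠ z ∧
    T.tree.Adj ⟨x, hx⟩ y ∧ T.tree.Adj ⟨x, hx⟩ z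

/-- `mstCost c R` is the minimum cost of a tree whose vertex set is exactly
`R` (it is `0` when `|R| = 1`). -/
noncomputable def mstCost {V : Type*} [Fintype V] (c : V → V → ℝ) (R : Finset V) : ℝ :=
  sInf {x : ℝ | ∃ T : SimpleGraph {v : V // v ∈ R},
    T.IsTree ∧ graphCost (fun a b => c a.1 b.1) T = x}

/-- The pairs of consecutive entries of a list. -/
def consecutivePairs {α : Type*} (l : List α) : List (α × α) := l.zip l.tail

/-- The total cost of a list of pairs. -/
def pairsCost {α : Type*} (c : α → α → ℝ) (l : List (α × α)) : ℝ :=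
  (l.map fun p => c p.1 p.2).sum

/-- The cost of the path visiting the entries of a list in order. -/
def pathCost {α : Type*} (c : α → α → ℝ) (l : List α) : ℝ := pairsCost c (consecutivePairs l)

section Lists

variable {α β : Type*}

@[simp] lemma consecutivePairs_nil : consecutivePairs ([] : List α) = [] := rfl

@[simp] lemma consecutivePairs_singleton (a : α) : consecutivePairs [a] = [] := rfl

@[simp] lemma consecutivePairs_cons_cons (a b : α) (l : List α) :
    consecutivePairs (a :: b :: l) = (a, b) :: consecutivePairs (b :: l) := rfl

lemma length_consecutivePairs (l : List α) : (consecutivePairs l).length = l.length - 1 := by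
  simp [consecutivePairs]

lemma consecutivePairs_map (f : α → β) (l : List α) :
    consecutivePairs (l.map f) = (consecutivePairs l).map (Prod.map f f) := by
  simp only [consecutivePairs, ← List.map_tail, List.zip_map]

lemma mem_of_mem_consecutivePairs {l : List α} {p : α × α} (hp : p ∈ consecutivePairs l) :
    p.1 ∈ l ∧ p.2 ∈ l :=
  ⟨(List.of_mem_zip hp).1, List.mem_of_mem_tail (List.of_mem_zip hp).2⟩

lemma ne_of_mem_consecutivePairs {l : List α} (hl : l.Nodup) {p : α × α}
    (hp : p ∈ consecutivePairs l) : p.1 ≠ p.2 := by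
  induction l with
  | nil => simp at hp
  | cons a l ih =>
    cases l with
    | nil => simp at hp
    | cons b l =>
      rcases List.mem_cons.1 hp with rfl | hp
      · rintro (rfl : a = b)
        simp at hl
      · exact ih (List.nodup_cons.1 hl).2 hp

@[simp] lemma pairsCost_nil (c : α → α → ℝ) : pairsCost c [] = 0 := rfl

@[simp] lemma pairsCost_cons (c : α → α → ℝ) (p : α × α) (l : List (α × α)) :
    pairsCost c (p :: l) = c p.1 p.2 + pairsCost c l := by
  simp [pairsCost]

@[simp] lemma pairsCost_append (c : α → α → ℝ) (l l' : List (α × α)) :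
    pairsCost c (l ++ l') = pairsCost c l + pairsCost c l' := by
  simp [pairsCost]

lemma pairsCost_one (l : List (α × α)) : pairsCost (fun _ _ => 1) l = l.length := by
  simp [pairsCost]

@[simp] lemma pathCost_nil (c : α → α → ℝ) : pathCost c [] = 0 := rfl

@[simp] lemma pathCost_singleton (c : α → α → ℝ) (a : α) : pathCost c [a] = 0 := rfl

@[simp] lemma pathCost_cons_cons (c : α → α → ℝ) (a b : α) (l : List α) :
    pathCost c (a :: b :: l) = c a b + pathCost c (b :: l) := by
  simp [pathCost]

lemma pathCost_map (c : β → β → ℝ) (f : α → β) (l : List α) :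
    pathCost c (l.map f) = pathCost (fun a b => c (f a) (f b)) l := by
  simp [pathCost, pairsCost, consecutivePairs_map, Function.comp_def]

lemma pathCost_cons_le {c : α → α → ℝ} (hnn : ∀ u v, 0 ≤ c u v)
    (htri : ∀ u v w, c u w ≤ c u v + c v w) (a b : α) (l : List α) :
    pathCost c (a :: l) ≤ c a b + pathCost c (b :: l) := by
  cases l with
  | nil => simpa using hnn a b
  | cons d l => simp only [pathCost_cons_cons]; linarith [htri a b d]

lemma pathCost_cons_le_of_sublist {c : α → α → ℝ} (hnn : ∀ u v, 0 ≤ c u v)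
    (htri : ∀ u v w, c u w ≤ c u v + c v w) {l l' : List α} (h : l.Sublist l') (a : α) :
    pathCost c (a :: l) ≤ pathCost c (a :: l') := by
  induction h generalizing a with
  | slnil => exact le_rfl
  | cons b h ih =>
    rw [pathCost_cons_cons]
    exact (pathCost_cons_le hnn htri a b _).trans (by linarith [ih b])
  | cons_cons b h ih =>
    simp only [pathCost_cons_cons]
    linarith [ih b]

lemma pathCost_append_pair {c : α → α → ℝ} (a : α) (l : List α) (b : α) :
    pathCost c (l ++ [a, b]) = pathCost c (l ++ [a]) + c a b := by
  induction l with
  | nil => simp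
  | cons x l ih =>
    cases l with
    | nil => simp
    | cons y l =>
      simp only [List.cons_append, pathCost_cons_cons] at ih ⊢
      linarith

lemma pathCost_reverse {c : α → α → ℝ} (hsymm : ∀ u v, c u v = c v u) (l : List α) :
    pathCost c l.reverse = pathCost c l := by
  induction l with
  | nil => rfl
  | cons a l ih =>
    cases l with
    | nil => rfl
    | cons b l =>
      rw [pathCost_cons_cons, ← ih, List.reverse_cons, List.reverse_cons, List.append_assoc,
        List.cons_append, List.nil_append, pathCost_append_pair, hsymm b a, add_comm]

/-- A new entry `z` can be inserted into a path next to the entry `a`, strictly between the ends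
of the path, at an additional cost of at most `2 * c a z`. -/
lemma exists_perm_pathCost_insert {c : α → α → ℝ} (hsymm : ∀ u v, c u v = c v u)
    (htri : ∀ u v w, c u w ≤ c u v + c v w) (a z v : α) (M : List α) (u : α)
    (ha : a ∈ u :: (M ++ [v])) :
    ∃ M' : List α, M'.Perm (z :: M) ∧
      pathCost c (u :: (M' ++ [v])) ≤ pathCost c (u :: (M ++ [v])) + 2 * c a z := by
  induction M generalizing u with
  | nil =>
    refine ⟨[z], List.Perm.refl _, ?_⟩
    simp only [List.nil_append, List.mem_cons, List.not_mem_nil, or_false] at ha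
    simp only [List.cons_append, List.nil_append, pathCost_cons_cons, pathCost_singleton]
    rcases ha with rfl | rfl
    · linarith [htri z a v, hsymm z a]
    · linarith [htri u a z, hsymm z a]
  | cons m M ih =>
    by_cases hau : a = u
    · subst hau
      refine ⟨z :: m :: M, List.Perm.refl _, ?_⟩
      simp only [List.cons_append, pathCost_cons_cons]
      linarith [htri z a m, hsymm z a]
    · obtain ⟨M', hM', hc⟩ := ih m (by simpa [hau] using ha)
      refine ⟨m :: M', (hM'.cons m).trans (List.Perm.swap z m M), ?_⟩
      simp only [List.cons_append, pathCost_cons_cons]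
      linarith

lemma exists_consecutivePairs_of_mem (v x : α) (M : List α) (u : α)
    (hnd : (u :: (M ++ [v])).Nodup) (hx : x ∈ M) :
    ∃ y z, y ≠ z ∧ (y, x) ∈ consecutivePairs (u :: (M ++ [v])) ∧
      (x, z) ∈ consecutivePairs (u :: (M ++ [v])) := by
  induction M generalizing u with
  | nil => simp at hx
  | cons m M ih =>
    rcases List.mem_cons.1 hx with rfl | hx
    · cases M with
      | nil => exact ⟨u, v, by aesop, by simp, by simp⟩
      | cons n M => exact ⟨u, n, by aesop, by simp, by simp⟩
    · obtain ⟨y, z, hyz, h₁, h₂⟩ := ih m (List.nodup_cons.1 hnd).2 hx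
      exact ⟨y, z, hyz, List.mem_cons_of_mem _ h₁, List.mem_cons_of_mem _ h₂⟩

lemma reachable_of_consecutivePairs {G : SimpleGraph α} (a : α) (l : List α)
    (h : ∀ p ∈ consecutivePairs (a :: l), G.Adj p.1 p.2) {x : α} (hx : x ∈ a :: l) :
    G.Reachable a x := by
  induction l generalizing a with
  | nil => simp_all
  | cons b l ih =>
    rcases List.mem_cons.1 hx with rfl | hx
    · rfl
    · exact (h (a, b) (by simp)).reachable.trans
        (ih b (fun p hp => h p (List.mem_cons_of_mem _ hp)) hx)

lemma connected_of_consecutivePairs {G : SimpleGraph α} (l : List α) (hl : l ≠ [])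
    (hmem : ∀ x, x ∈ l) (h : ∀ p ∈ consecutivePairs l, G.Adj p.1 p.2) : G.Connected := by
  obtain ⟨a, l, rfl⟩ := List.exists_cons_of_ne_nil hl
  have : Nonempty α := ⟨a⟩
  exact ⟨fun x y => (reachable_of_consecutivePairs a l h (hmem x)).symm.trans
    (reachable_of_consecutivePairs a l h (hmem y))⟩

end Lists

section GraphCost

variable {α β : Type*} [Fintype α] [Fintype β]

lemma graphCost_nonneg_s12 {c : α → α → ℝ} (hnn : ∀ u v, 0 ≤ c u v) (G : SimpleGraph α) :
    0 ≤ graphCost c G := by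
  unfold graphCost
  refine div_nonneg (Finset.sum_nonneg fun x _ => Finset.sum_nonneg fun y _ => ?_) zero_le_two
  split_ifs
  exacts [hnn _ _, le_rfl]

lemma graphCost_mono {c : α → α → ℝ} (hnn : ∀ u v, 0 ≤ c u v) {G H : SimpleGraph α}
    (h : G ≤ H) : graphCost c G ≤ graphCost c H := by
  unfold graphCost
  gcongr with x _ y _
  split_ifs with h₁ h₂
  exacts [le_rfl, absurd (h h₁) h₂, hnn _ _, le_rfl]

lemma graphCost_one (G : SimpleGraph α) :
    graphCost (fun _ _ => 1) G = Nat.card G.edgeSet := by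
  have h := G.two_mul_card_edgeFinset
  have h' : Nat.card G.edgeSet = G.edgeFinset.card := by
    rw [Nat.card_eq_fintype_card, SimpleGraph.edgeFinset_card]
  rw [graphCost, ← Fintype.sum_prod_type' (f := fun x y => if G.Adj x y then (1 : ℝ) else 0),
    Finset.sum_boole, h', div_eq_iff two_ne_zero, mul_comm]
  exact_mod_cast h.symm

/-- Every graph has a list of its edges, each listed once with some orientation. -/
lemma exists_edge_list (G : SimpleGraph α) :
    ∃ l : List (α × α), (∀ p ∈ l, G.Adj p.1 p.2) ∧
      (∀ x y, G.Adj x y → (x, y) ∈ l ∨ (y, x) ∈ l) ∧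
      ∀ c : α → α → ℝ, (∀ u v, c u v = c v u) → pairsCost c l = graphCost c G := by
  let e := Fintype.equivFin α
  let s : Finset (α × α) := Finset.univ.filter fun p => G.Adj p.1 p.2 ∧ e p.1 < e p.2
  refine ⟨s.toList, ?_, ?_, ?_⟩
  · intro p hp
    exact (Finset.mem_filter.1 (Finset.mem_toList.1 hp)).2.1
  · intro x y h
    simp only [Finset.mem_toList, s, Finset.mem_filter, Finset.mem_univ, true_and]
    rcases lt_or_gt_of_ne (e.injective.ne h.ne) with h' | h'
    exacts [Or.inl ⟨h, h'⟩, Or.inr ⟨h.symm, h'⟩]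
  · intro c hc
    have h₁ : pairsCost c s.toList =
        ∑ x, ∑ y, if G.Adj x y ∧ e x < e y then c x y else 0 := by
      rw [pairsCost, Finset.sum_map_toList, Finset.sum_filter,
        ← Fintype.sum_prod_type' (f := fun x y => if G.Adj x y ∧ e x < e y then c x y else 0)]
    have h₂ : pairsCost c s.toList =
        ∑ x, ∑ y, if G.Adj x y ∧ e y < e x then c x y else 0 := by
      rw [h₁, Finset.sum_comm]
      refine Finset.sum_congr rfl fun x _ => Finset.sum_congr rfl fun y _ => ?_
      rw [G.adj_comm, hc]
    rw [graphCost, eq_div_iff two_ne_zero, mul_two]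
    nth_rw 1 [h₁]
    rw [h₂, ← Finset.sum_add_distrib]
    refine Finset.sum_congr rfl fun x _ => ?_
    rw [← Finset.sum_add_distrib]
    refine Finset.sum_congr rfl fun y _ => ?_
    by_cases h : G.Adj x y
    · rcases lt_or_gt_of_ne (e.injective.ne h.ne) with h' | h'
      · simp [h, h', h'.not_gt]
      · simp [h, h', h'.not_gt]
    · simp [h]

lemma graphCost_fromRel_le {c : α → α → ℝ} (hnn : ∀ u v, 0 ≤ c u v)
    (hsymm : ∀ u v, c u v = c v u) (l : List (α × α)) :
    graphCost c (SimpleGraph.fromRel fun x y => (x, y) ∈ l) ≤ pairsCost c l := by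
  have h₁ : ∑ x, ∑ y, (if (x, y) ∈ l then c x y else 0) ≤ pairsCost c l := by
    rw [← Fintype.sum_prod_type' (f := fun x y => if (x, y) ∈ l then c x y else 0)]
    induction l with
    | nil => simp
    | cons p l ih =>
      rw [pairsCost_cons]
      refine le_trans ?_ (add_le_add_right ih _)
      rw [← Fintype.sum_ite_eq' p (fun q : α × α => c q.1 q.2), ← Finset.sum_add_distrib]
      refine Finset.sum_le_sum fun q _ => ?_
      have := hnn q.1 q.2
      by_cases hq : q = p <;> by_cases hq' : q ∈ l <;> simp [hq, hq'] <;> simp_all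
  have h₂ : ∑ x, ∑ y, (if (y, x) ∈ l then c x y else 0) =
      ∑ x, ∑ y, (if (x, y) ∈ l then c x y else 0) := by
    rw [Finset.sum_comm]
    refine Finset.sum_congr rfl fun x _ => Finset.sum_congr rfl fun y _ => ?_
    rw [hsymm]
  rw [graphCost, div_le_iff₀ two_pos, mul_two]
  refine le_trans ?_ (add_le_add h₁ (h₂.le.trans h₁))
  rw [← Finset.sum_add_distrib]
  refine Finset.sum_le_sum fun x _ => ?_
  rw [← Finset.sum_add_distrib]
  refine Finset.sum_le_sum fun y _ => ?_
  have := hnn x y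
  simp only [SimpleGraph.fromRel_adj]
  split_ifs <;> first | linarith | simp_all

lemma card_edgeSet_fromRel_le (l : List (α × α)) :
    Nat.card (SimpleGraph.fromRel fun x y => (x, y) ∈ l).edgeSet ≤ l.length := by
  have h := graphCost_fromRel_le (c := fun _ _ => 1) (fun _ _ => zero_le_one)
    (fun _ _ => rfl) l
  rw [graphCost_one, pairsCost_one] at h
  exact_mod_cast h

/-- The image of a connected graph under a surjection that does not increase edge costs contains
a spanning tree that is no more expensive. -/
lemma exists_isTree_graphCost_le {c : α → α → ℝ} {d : β → β → ℝ} {f : α → β}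
    (hf : Function.Surjective f) (hc : ∀ u v, 0 ≤ c u v) (hd : ∀ u v, 0 ≤ d u v)
    {G : SimpleGraph α} (hG : G.Connected)
    (hle : ∀ x y, G.Adj x y → f x ≠ f y → d (f x) (f y) ≤ c x y) :
    ∃ T : SimpleGraph β, T.IsTree ∧ graphCost d T ≤ graphCost c G := by
  obtain ⟨H, hHadj⟩ : ∃ H : SimpleGraph β, ∀ w w',
      H.Adj w w' ↔ w ≠ w' ∧ ∃ x y, G.Adj x y ∧ f x = w ∧ f y = w' :=
    ⟨{ Adj := fun w w' => w ≠ w' ∧ ∃ x y, G.Adj x y ∧ f x = w ∧ f y = w'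
       symm := ⟨fun w w' ⟨h, x, y, hxy, hx, hy⟩ => ⟨h.symm, y, x, hxy.symm, hy, hx⟩⟩
       loopless := ⟨fun w h => h.1 rfl⟩ }, fun _ _ => Iff.rfl⟩
  have hreach : ∀ x y, G.Reachable x y → H.Reachable (f x) (f y) := by
    rintro x y ⟨p⟩
    induction p with
    | nil => rfl
    | @cons x y z h p ih =>
      by_cases hxy : f x = f y
      · rwa [hxy]
      · exact SimpleGraph.Reachable.trans
          ((hHadj _ _).2 ⟨hxy, x, y, h, rfl, rfl⟩).reachable ih
  have hH : H.Connected := by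
    have : Nonempty β := hG.nonempty.map f
    refine ⟨fun w w' => ?_⟩
    obtain ⟨x, rfl⟩ := hf w
    obtain ⟨y, rfl⟩ := hf w'
    exact hreach x y (hG.preconnected x y)
  obtain ⟨T, hT, hTree⟩ := hH.exists_isTree_le
  refine ⟨T, hTree, (graphCost_mono hd hT).trans ?_⟩
  unfold graphCost
  gcongr
  rw [← Fintype.sum_prod_type' (f := fun w w' => if H.Adj w w' then d w w' else 0),
    ← Fintype.sum_prod_type' (f := fun x y => if G.Adj x y then c x y else 0),
    ← Finset.sum_fiberwise (s := Finset.univ) (g := fun p : α × α => (f p.1, f p.2))]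
  refine Finset.sum_le_sum fun q _ => ?_
  have hterm : ∀ p : α × α, 0 ≤ if G.Adj p.1 p.2 then c p.1 p.2 else 0 := fun p => by
    split_ifs
    exacts [hc _ _, le_rfl]
  split_ifs with h
  · obtain ⟨hne, x, y, hxy, hx, hy⟩ := (hHadj _ _).1 h
    calc d q.1 q.2 ≤ c x y := by
          rw [← hx, ← hy]
          exact hle x y hxy (by rwa [hx, hy])
      _ = if G.Adj (x, y).1 (x, y).2 then c (x, y).1 (x, y).2 else 0 := by simp [hxy]
      _ ≤ _ := Finset.single_le_sum
          (f := fun p : α × α => if G.Adj p.1 p.2 then c p.1 p.2 else 0)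
          (fun p _ => hterm p)
          (Finset.mem_filter.2 ⟨Finset.mem_univ _, by rw [hx, hy]⟩)
  · exact Finset.sum_nonneg fun p _ => hterm p

end GraphCost

section Trees

lemma graphCost_induce_add_le {α : Type*} [Fintype α] {c : α → α → ℝ}
    (hnn : ∀ u v, 0 ≤ c u v) (hsymm : ∀ u v, c u v = c v u) (G : SimpleGraph α) {a z : α}
    (h : G.Adj a z) :
    graphCost (fun x y : {x // x ≠ z} => c x y) (G.induce {x | x ≠ z}) + c a z ≤
      graphCost c G := by
  have hterm : ∀ x y, 0 ≤ if G.Adj x y then c x y else 0 := fun x y => by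
    split_ifs
    exacts [hnn _ _, le_rfl]
  have h₁ : c a z ≤ ∑ y, if G.Adj z y then c z y else 0 := by
    refine le_trans ?_ (Finset.single_le_sum (fun y _ => hterm z y) (Finset.mem_univ a))
    rw [if_pos h.symm, hsymm]
  have h₂ : c a z ≤ ∑ x : {x // x ≠ z}, if G.Adj x z then c x z else 0 := by
    refine le_trans ?_ (Finset.single_le_sum (f := fun x : {x // x ≠ z} =>
      if G.Adj x z then c x z else 0) (fun x _ => hterm x z) (Finset.mem_univ ⟨a, h.ne⟩))
    rw [if_pos h]
  have h₃ : ∑ x, ∑ y, (if G.Adj x y then c x y else 0) =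
      (∑ y, if G.Adj z y then c z y else 0) +
        ((∑ x : {x // x ≠ z}, if G.Adj x z then c x z else 0) +
          ∑ x : {x // x ≠ z}, ∑ y : {x // x ≠ z}, if G.Adj x y then c x y else 0) := by
    rw [Fintype.sum_eq_add_sum_subtype_ne _ z, ← Finset.sum_add_distrib]
    congr 1
    exact Finset.sum_congr rfl fun x _ => Fintype.sum_eq_add_sum_subtype_ne _ z
  have h₄ : graphCost (fun x y : {x // x ≠ z} => c x y) (G.induce {x | x ≠ z}) =
      (∑ x : {x // x ≠ z}, ∑ y : {x // x ≠ z}, if G.Adj x y then c x y else 0) / 2 := rfl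
  rw [h₄, graphCost, h₃]
  linarith

/-- In a connected graph with a metric cost, any two distinct vertices are the ends of a
Hamiltonian path of the complete graph whose cost is at most twice the cost of the graph. -/
theorem exists_hamiltonian_path {α : Type*} [Fintype α] {c : α → α → ℝ}
    (hnn : ∀ u v, 0 ≤ c u v) (hsymm : ∀ u v, c u v = c v u)
    (htri : ∀ u v w, c u w ≤ c u v + c v w) {G : SimpleGraph α} (hG : G.Connected)
    {u v : α} (huv : u ≠ v) :
    ∃ M : List α, (u :: (M ++ [v])).Nodup ∧ (∀ x, x ∈ u :: (M ++ [v])) ∧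
      pathCost c (u :: (M ++ [v])) ≤ 2 * graphCost c G - c u v := by
  induction hn : Fintype.card α generalizing α with
  | zero => exact ((Fintype.card_eq_zero_iff.1 hn).false u).elim
  | succ n ih =>
  have : Nontrivial α := ⟨u, v, huv⟩
  obtain ⟨z, hz⟩ := hG.exists_connected_induce_compl_singleton_of_finite_nontrivial
  obtain ⟨a, hza⟩ := hG.preconnected.exists_adj_of_nontrivial z
  have haz := hza.symm.ne
  have hcost := graphCost_induce_add_le hnn hsymm G hza.symm
  have hz : (G.induce {x | x ≠ z}).Connected := hz
  have hpath : ∀ u v : α, u ≠ v → u ≠ z → v ≠ z →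
      ∃ M : List α, (u :: (M ++ [v])).Nodup ∧ (∀ x, x ∈ u :: (M ++ [v]) ↔ x ≠ z) ∧
        pathCost c (u :: (M ++ [v])) ≤ 2 * graphCost c G - 2 * c a z - c u v := by
    intro u v huv hu hv
    obtain ⟨M, hnd, hmem, hM⟩ := ih (α := {x // x ≠ z}) (c := fun x y => c x y)
      (fun _ _ => hnn _ _) (fun _ _ => hsymm _ _) (fun _ _ _ => htri _ _ _) hz
      (u := ⟨u, hu⟩) (v := ⟨v, hv⟩) (by simpa using huv)
      (by rw [Fintype.card_subtype_compl, Fintype.card_subtype_eq, hn]; rfl)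
    have hmap : (⟨u, hu⟩ :: (M ++ [⟨v, hv⟩]) : List {x // x ≠ z}).map Subtype.val =
        u :: (M.map Subtype.val ++ [v]) := by simp
    refine ⟨M.map Subtype.val, ?_, fun x => ?_, ?_⟩
    · rw [← hmap]
      exact hnd.map Subtype.val_injective
    · rw [← hmap, List.mem_map]
      exact ⟨fun ⟨y, _, hy⟩ => hy ▸ y.2, fun hx => ⟨⟨x, hx⟩, hmem _, rfl⟩⟩
    · rw [← hmap, pathCost_map]
      linarith
  have hend : ∀ v : α, z ≠ v → ∃ M : List α, (z :: (M ++ [v])).Nodup ∧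
      (∀ x, x ∈ z :: (M ++ [v])) ∧ pathCost c (z :: (M ++ [v])) ≤ 2 * graphCost c G - c z v := by
    intro v hzv
    have hcons : ∀ b, b ≠ v → b ≠ z → c z b + c z v ≤ 2 * c a z + c b v →
        ∃ M : List α, (z :: (M ++ [v])).Nodup ∧ (∀ x, x ∈ z :: (M ++ [v])) ∧
          pathCost c (z :: (M ++ [v])) ≤ 2 * graphCost c G - c z v := by
      intro b hbv hbz hle
      obtain ⟨M, hnd, hmem, hM⟩ := hpath b v hbv hbz hzv.symm
      refine ⟨b :: M, List.nodup_cons.2 ⟨fun h => (hmem z).1 h rfl, hnd⟩, fun x => ?_, ?_⟩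
      · by_cases hx : x = z
        · simp [hx]
        · exact List.mem_cons_of_mem _ ((hmem x).2 hx)
      · simp only [List.cons_append, pathCost_cons_cons]
        linarith
    by_cases hav : a = v
    · subst hav
      by_cases hb : ∃ b, b ≠ a ∧ b ≠ z
      · obtain ⟨b, hba, hbz⟩ := hb
        exact hcons b hba hbz (by linarith [htri z a b, hsymm a z, hsymm a b])
      · push Not at hb
        refine ⟨[], by simpa using hzv, fun x => ?_, ?_⟩
        · by_cases hx : x = a
          · simp [hx]
          · simp [hb x hx]
        · have := graphCost_nonneg_s12 (c := fun x y : {x // x ≠ z} => c x y)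
            (fun _ _ => hnn _ _) (G.induce {x | x ≠ z})
          simp only [List.nil_append, pathCost_cons_cons, pathCost_singleton]
          linarith [hsymm a z]
    · exact hcons a hav haz (by linarith [htri z a v, hsymm a z])
  by_cases huz : u = z
  · subst huz
    exact hend v huv
  by_cases hvz : v = z
  · subst hvz
    obtain ⟨M, hnd, hmem, hM⟩ := hend u huv.symm
    have hrev : (v :: (M ++ [u])).reverse = u :: (M.reverse ++ [v]) := by simp
    refine ⟨M.reverse, ?_, fun x => ?_, ?_⟩
    · rw [← hrev]
      exact List.nodup_reverse.2 hnd
    · rw [← hrev]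
      exact List.mem_reverse.2 (hmem x)
    · rw [← hrev, pathCost_reverse hsymm, hsymm u v]
      exact hM
  obtain ⟨M, hnd, hmem, hM⟩ := hpath u v huv huz hvz
  obtain ⟨M', hperm, hM'⟩ := exists_perm_pathCost_insert hsymm htri a z v M u ((hmem a).2 haz)
  have hp : (u :: (M' ++ [v])).Perm (z :: u :: (M ++ [v])) :=
    ((hperm.append_right [v]).cons u).trans (List.Perm.swap z u (M ++ [v]))
  refine ⟨M', hp.nodup_iff.2 (List.nodup_cons.2 ⟨fun h => (hmem z).1 h rfl, hnd⟩),
    fun x => hp.mem_iff.2 ?_, by linarith⟩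
  by_cases hx : x = z
  · simp [hx]
  · exact List.mem_cons_of_mem _ ((hmem x).2 hx)

/-- Blowing up the vertices of a tree into paths gives a tree. -/
theorem exists_isTree_blowup {α β : Type*} [Fintype α] [Fintype β] {c : α → α → ℝ}
    (hnn : ∀ u v, 0 ≤ c u v) (hsymm : ∀ u v, c u v = c v u) {d : β → β → ℝ}
    (hd : ∀ u v, d u v = d v u) (f : α → β) (L : β → List α) (hL : ∀ w, L w ≠ [])
    (hnd : ∀ w, (L w).Nodup) (hmem : ∀ w x, x ∈ L w ↔ f x = w)
    (hle : ∀ w w', w ≠ w' → ∃ x y, f x = w ∧ f y = w' ∧ c x y ≤ d w w')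
    {S : SimpleGraph β} (hS : S.IsTree) :
    ∃ G : SimpleGraph α, G.IsTree ∧ (∀ w, ∀ p ∈ consecutivePairs (L w), G.Adj p.1 p.2) ∧
      graphCost c G ≤ ∑ w, pathCost c (L w) + graphCost d S := by
  obtain ⟨l, hlS, hSl, hlc⟩ := exists_edge_list S
  have hlen : l.length = Nat.card S.edgeSet := by
    have := hlc (fun _ _ => 1) fun _ _ => rfl
    rw [pairsCost_one, graphCost_one] at this
    exact_mod_cast this
  have hq : ∀ p : β × β, ∃ q : α × α, p.1 ≠ p.2 →
      f q.1 = p.1 ∧ f q.2 = p.2 ∧ c q.1 q.2 ≤ d p.1 p.2 := by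
    intro p
    by_cases hp : p.1 = p.2
    · obtain ⟨x, _⟩ := List.exists_mem_of_ne_nil _ (hL p.1)
      exact ⟨(x, x), fun h => absurd hp h⟩
    · obtain ⟨x, y, h⟩ := hle _ _ hp
      exact ⟨(x, y), fun _ => h⟩
  choose q hq using hq
  let m : List (α × α) := Finset.univ.toList.flatMap fun w => consecutivePairs (L w)
  have hmcost : ∀ e : α → α → ℝ, pairsCost e m = ∑ w, pathCost e (L w) := by
    intro e
    rw [← Finset.sum_map_toList]
    simp only [m]
    induction (Finset.univ : Finset β).toList with
    | nil => rfl
    | cons w t ih => rw [List.flatMap_cons, pairsCost_append, ih]; rfl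
  let E : List (α × α) := m ++ l.map q
  let G : SimpleGraph α := SimpleGraph.fromRel fun x y => (x, y) ∈ E
  have hpath : ∀ w, ∀ p ∈ consecutivePairs (L w), G.Adj p.1 p.2 := by
    intro w p hp
    refine (SimpleGraph.fromRel_adj _ _ _).2 ⟨?_, Or.inl ?_⟩
    · exact ne_of_mem_consecutivePairs (hnd w) hp
    · exact List.mem_append_left _ (List.mem_flatMap.2 ⟨w, by simp, hp⟩)
  have hfib : ∀ x y, f x = f y → G.Reachable x y := by
    intro x y hxy
    obtain ⟨a, t, hat⟩ := List.exists_cons_of_ne_nil (hL (f x))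
    have key : ∀ z, f z = f x → G.Reachable a z := fun z hz =>
      reachable_of_consecutivePairs a t (by rw [← hat]; exact hpath _)
        (by rw [← hat]; exact (hmem _ _).2 hz)
    exact (key x rfl).symm.trans (key y hxy.symm)
  have hcross : ∀ w w', S.Adj w w' → ∃ x y, f x = w ∧ f y = w' ∧ G.Adj x y := by
    intro w w' h
    have key : ∀ p ∈ l, f (q p).1 = p.1 ∧ f (q p).2 = p.2 ∧ G.Adj (q p).1 (q p).2 := by
      intro p hp
      have hpne := (hlS p hp).ne
      obtain ⟨h₁, h₂, -⟩ := hq p hpne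
      refine ⟨h₁, h₂, (SimpleGraph.fromRel_adj _ _ _).2 ⟨fun h => ?_, Or.inl ?_⟩⟩
      · exact hpne (by rw [← h₁, ← h₂, h])
      · exact List.mem_append_right _ (List.mem_map_of_mem hp)
    rcases hSl w w' h with h | h
    · exact ⟨_, _, key _ h⟩
    · obtain ⟨h₁, h₂, h₃⟩ := key _ h
      exact ⟨_, _, h₂, h₁, h₃.symm⟩
  have hconn : G.Connected := by
    obtain ⟨w⟩ := hS.connected.nonempty
    obtain ⟨x, _⟩ := List.exists_mem_of_ne_nil _ (hL w)
    have : Nonempty α := ⟨x⟩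
    have key : ∀ w w', S.Reachable w w' → ∀ x y, f x = w → f y = w' → G.Reachable x y := by
      rintro w w' ⟨p⟩
      induction p with
      | nil => exact fun x y hx hy => hfib x y (hx.trans hy.symm)
      | cons h p ih =>
        intro x y hx hy
        obtain ⟨x', y', hx', hy', hadj⟩ := hcross _ _ h
        exact ((hfib x x' (hx.trans hx'.symm)).trans hadj.reachable).trans (ih y' y hy' hy)
    exact ⟨fun x y => key _ _ (hS.connected.preconnected (f x) (f y)) x y rfl rfl⟩
  have hElen : E.length + 1 = Nat.card α := by
    have h₁ : m.length + Nat.card β = Nat.card α := by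
      rw [Nat.card_eq_fintype_card, Nat.card_eq_fintype_card]
      have hα : Fintype.card α = ∑ w, (L w).length := by
        rw [← Finset.card_univ, Finset.card_eq_sum_card_fiberwise (f := f) (t := Finset.univ)
          (fun _ _ => Finset.mem_coe.2 (Finset.mem_univ _))]
        refine Finset.sum_congr rfl fun w _ => ?_
        rw [← List.toFinset_card_of_nodup (hnd w)]
        congr 1
        ext x
        simp [hmem]
      have hm : m.length = ∑ w, ((L w).length - 1) := by
        rw [← Finset.sum_map_toList]
        simp [m, List.length_flatMap, length_consecutivePairs]
      rw [hm, hα, ← Finset.card_univ, Finset.card_eq_sum_ones, ← Finset.sum_add_distrib]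
      refine Finset.sum_congr rfl fun w _ => ?_
      have := List.length_pos_iff.2 (hL w)
      omega
    have h₂ := (SimpleGraph.isTree_iff_connected_and_card.1 hS).2
    simp only [E, List.length_append, List.length_map]
    omega
  refine ⟨G, SimpleGraph.isTree_iff_connected_and_card.2 ⟨hconn, le_antisymm ?_ ?_⟩, hpath, ?_⟩
  · rw [← hElen]
    exact Nat.add_le_add_right (card_edgeSet_fromRel_le E) 1
  · exact hconn.card_vert_le_card_edgeSet_add_one
  · refine (graphCost_fromRel_le hnn hsymm E).trans ?_
    rw [pairsCost_append, hmcost, ← hlc d hd]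
    gcongr
    rw [pairsCost, pairsCost, List.map_map]
    exact List.sum_le_sum fun p hp => (hq p (hlS p hp).ne).2.2

/-- In a connected graph, disjoint connected vertex sets can be enlarged to a partition of the
vertices into connected sets. -/
theorem exists_connected_partition {α ι : Type*} [Fintype α] [Nonempty ι]
    {G : SimpleGraph α} (hG : G.Connected) (A : ι → Set α)
    (hA : ∀ i, (G.induce (A i)).Connected) (hdisj : ∀ i j, i ≠ j → Disjoint (A i) (A j)) :
    ∃ B : ι → Set α, (∀ i, A i ⊆ B i) ∧ (∀ x, ∃ i, x ∈ B i) ∧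
      (∀ i j, i ≠ j → Disjoint (B i) (B j)) ∧ ∀ i, (G.induce (B i)).Connected := by
  induction hn : (⋃ i, A i)ᶜ.ncard generalizing A with
  | zero =>
    refine ⟨A, fun i => subset_rfl, fun x => ?_, hdisj, hA⟩
    have hempty : (⋃ i, A i)ᶜ = ∅ := (Set.ncard_eq_zero (Set.toFinite _)).1 hn
    exact Set.mem_iUnion.1 (Set.compl_empty_iff.1 hempty ▸ Set.mem_univ x)
  | succ n ih =>
    obtain ⟨y, hy⟩ : (⋃ i, A i)ᶜ.Nonempty := by
      rw [← Set.ncard_pos (Set.toFinite _)]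
      omega
    obtain ⟨⟨x, hx⟩⟩ := (hA (Classical.arbitrary ι)).nonempty
    obtain ⟨p⟩ := hG.preconnected x y
    obtain ⟨e, -, he₁, he₂⟩ := p.exists_boundary_dart (⋃ i, A i)
      (Set.mem_iUnion.2 ⟨_, hx⟩) hy
    obtain ⟨i, hi⟩ := Set.mem_iUnion.1 he₁
    have hsub : ∀ j, A j ⊆ Function.update A i (A i ∪ {e.snd}) j := by
      intro j
      by_cases hj : j = i
      · subst hj; simp
      · simp [hj]
    have hnot : ∀ j, e.snd ∉ A j := fun j hj => he₂ (Set.mem_iUnion.2 ⟨j, hj⟩)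
    obtain ⟨B, hAB, hB⟩ := ih (Function.update A i (A i ∪ {e.snd})) (fun j => by
        by_cases hj : j = i
        · subst hj
          rw [Function.update_self]
          exact SimpleGraph.connected_induce_union (hA j).preconnected
            (SimpleGraph.Preconnected.of_subsingleton) hi rfl e.adj
        · rw [Function.update_of_ne hj]
          exact hA j) (fun j j' hjj' => by
        by_cases hj : j = i
        · subst hj
          rw [Function.update_self, Function.update_of_ne hjj'.symm, Set.disjoint_union_left]
          exact ⟨hdisj _ _ hjj', Set.disjoint_singleton_left.2 (hnot j')⟩
        · rw [Function.update_of_ne hj]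
          by_cases hj' : j' = i
          · subst hj'
            rw [Function.update_self, Set.disjoint_union_right]
            exact ⟨hdisj _ _ hjj', Set.disjoint_singleton_right.2 (hnot j)⟩
          · rw [Function.update_of_ne hj']
            exact hdisj _ _ hjj') (by
        have : (⋃ j, Function.update A i (A i ∪ {e.snd}) j)ᶜ = (⋃ j, A j)ᶜ \ {e.snd} := by
          ext x
          simp only [Set.mem_compl_iff, Set.mem_iUnion, not_exists, Set.mem_sdiff,
            Set.mem_singleton_iff]
          refine ⟨fun h => ⟨fun j hj => h j (hsub j hj), fun hx => h i (by simp [hx])⟩,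
            fun h j hj => ?_⟩
          by_cases hji : j = i
          · subst hji
            rw [Function.update_self] at hj
            exact hj.elim (h.1 j) h.2
          · rw [Function.update_of_ne hji] at hj
            exact h.1 j hj
        rw [this, Set.ncard_sdiff_singleton_of_mem he₂, hn]
        rfl)
    exact ⟨B, fun j => (hsub j).trans (hAB j), hB⟩

end Trees

section Clusters

lemma connected_induce_of_consecutivePairs {α : Type*} {G : SimpleGraph α} {s : Set α}
    {l : List α} (hl : l ≠ []) (hmem : ∀ x, x ∈ l ↔ x ∈ s)
    (h : ∀ p ∈ consecutivePairs l, G.Adj p.1 p.2) : (G.induce s).Connected := by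
  refine connected_of_consecutivePairs (l.attachWith (· ∈ s) fun x hx => (hmem x).1 hx)
    (List.attachWith_ne_nil_iff.2 hl) (fun x => (List.mem_attachWith _ _).2 ((hmem _).2 x.2)) ?_
  intro p hp
  have hp' := List.mem_map_of_mem (f := Prod.map Subtype.val Subtype.val) hp
  rw [← consecutivePairs_map, List.attachWith_map_subtype_val] at hp'
  exact h _ hp'

lemma sum_graphCost_induce_le {α ι : Type*} [Fintype α] [Fintype ι] {c : α → α → ℝ}
    (hnn : ∀ u v, 0 ≤ c u v) (G : SimpleGraph α) (A : ι → Set α) [∀ i, Fintype (A i)]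
    (hA : ∀ i j, i ≠ j → Disjoint (A i) (A j)) :
    ∑ i, graphCost (fun x y : A i => c x y) (G.induce (A i)) ≤ graphCost c G := by
  let F : α × α → ℝ := fun p => if G.Adj p.1 p.2 then c p.1 p.2 else 0
  have hF : ∀ p, 0 ≤ F p := fun p => by
    simp only [F]
    split_ifs
    exacts [hnn _ _, le_rfl]
  let φ : (Σ i, A i × A i) → α × α := fun z => (z.2.1, z.2.2)
  have hφ : Function.Injective φ := by
    rintro ⟨i, x, y⟩ ⟨j, x', y'⟩ h
    simp only [φ, Prod.mk.injEq] at h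
    by_cases hij : i = j
    · subst hij
      simp [Subtype.ext h.1, Subtype.ext h.2]
    · exact absurd (h.1 ▸ x'.2) (Set.disjoint_left.1 (hA i j hij) x.2)
  have h₁ : ∀ i, graphCost (fun x y : A i => c x y) (G.induce (A i)) =
      (∑ p : A i × A i, F (φ ⟨i, p⟩)) / 2 := by
    intro i
    rw [graphCost, Fintype.sum_prod_type]
    rfl
  simp only [h₁]
  rw [← Finset.sum_div, graphCost, ← Fintype.sum_prod_type' (f := fun x y =>
    if G.Adj x y then c x y else 0)]
  gcongr
  rw [← Fintype.sum_sigma (f := fun z => F (φ z)), ← Finset.sum_image (f := F) (g := φ) hφ.injOn]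
  exact Finset.sum_le_univ_sum_of_nonneg hF

variable {V : Type*} {c : V → V → ℝ} {k : ℕ} {P : Fin k → Finset V}

lemma contractedCost_nonneg_s12 (hnn : ∀ u v, 0 ≤ c u v) (w w') : 0 ≤ contractedCost c P w w' := by
  rcases w with x | i <;> rcases w' with y | j
  · exact hnn _ _
  · exact Real.sInf_nonneg (by rintro _ ⟨u, -, rfl⟩; exact hnn _ _)
  · exact Real.sInf_nonneg (by rintro _ ⟨u, -, rfl⟩; exact hnn _ _)
  · simp only [contractedCost]
    split_ifs
    · exact le_rfl
    · exact Real.sInf_nonneg (by rintro _ ⟨u, -, rfl⟩; exact hnn _ _)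

lemma contractedCost_symm (hsymm : ∀ u v, c u v = c v u) (w w') :
    contractedCost c P w w' = contractedCost c P w' w := by
  rcases w with x | i <;> rcases w' with y | j
  · exact hsymm _ _
  · rfl
  · rfl
  · simp only [contractedCost, eq_comm (a := j)]
    congr 2
    ext r
    constructor <;> rintro ⟨⟨u, v⟩, h, rfl⟩ <;> exact ⟨(v, u), h.symm, hsymm _ _⟩

/-- The vertex of the contracted graph that a vertex is contracted to. -/
noncomputable def clusterMap (P : Fin k → Finset V) (v : V) :
    {x : V // ∀ i, x ∉ P i} ⊕ Fin k :=
  if h : ∃ i, v ∈ P i then Sum.inr h.choose else Sum.inl ⟨v, not_exists.1 h⟩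

lemma clusterMap_inl (x : {x : V // ∀ i, x ∉ P i}) : clusterMap P x.1 = Sum.inl x :=
  dif_neg (not_exists.2 x.2)

lemma clusterMap_eq_inl_iff {v : V} {x : {x : V // ∀ i, x ∉ P i}} :
    clusterMap P v = Sum.inl x ↔ v = x.1 := by
  refine ⟨fun h => ?_, fun h => h ▸ clusterMap_inl x⟩
  unfold clusterMap at h
  split_ifs at h
  rw [← Sum.inl_injective h]

lemma clusterMap_eq_inr_iff (hdisj : ∀ i j, i ≠ j → Disjoint (P i) (P j)) {v : V} {i : Fin k} :
    clusterMap P v = Sum.inr i ↔ v ∈ P i := by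
  unfold clusterMap
  split_ifs with h
  · rw [Sum.inr.injEq]
    refine ⟨fun hi => hi ▸ h.choose_spec, fun hi => by_contra fun hne => ?_⟩
    exact Finset.disjoint_left.1 (hdisj _ _ hne) h.choose_spec hi
  · simp only [false_iff]
    exact not_exists.1 h i

variable [Fintype V]

lemma mstCost_le_pathCost (hnn : ∀ u v, 0 ≤ c u v) (hsymm : ∀ u v, c u v = c v u)
    {R : Finset V} {l : List V} (hl : l ≠ []) (hnd : l.Nodup) (hmem : ∀ x, x ∈ l ↔ x ∈ R) :
    mstCost c R ≤ pathCost c l := by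
  have hmap := List.attachWith_map_subtype_val (p := (· ∈ R)) (l := l) fun x hx => (hmem x).1 hx
  set l' := l.attachWith (· ∈ R) fun x hx => (hmem x).1 hx with hl'
  have hnd' : l'.Nodup := by
    rw [← hmap] at hnd
    exact hnd.of_map _
  have hconn : (SimpleGraph.fromRel fun x y => (x, y) ∈ consecutivePairs l').Connected := by
    refine connected_of_consecutivePairs l' (List.attachWith_ne_nil_iff.2 hl)
      (fun x => (List.mem_attachWith _ _).2 ((hmem _).2 x.2)) fun p hp => ?_
    exact (SimpleGraph.fromRel_adj _ _ _).2 ⟨ne_of_mem_consecutivePairs hnd' hp, Or.inl hp⟩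
  obtain ⟨T, hT, hTree⟩ := hconn.exists_isTree_le
  have hmst : mstCost c R ≤ graphCost (fun a b => c a.1 b.1) T := by
    refine csInf_le (s := {x : ℝ | ∃ T : SimpleGraph {v : V // v ∈ R},
      T.IsTree ∧ graphCost (fun a b => c a.1 b.1) T = x}) ⟨0, ?_⟩ ⟨T, hTree, rfl⟩
    rintro _ ⟨T, -, rfl⟩
    exact graphCost_nonneg_s12 (fun _ _ => hnn _ _) T
  rw [← hmap, pathCost_map]
  exact hmst.trans ((graphCost_mono (fun _ _ => hnn _ _) hT).trans
    (graphCost_fromRel_le (fun _ _ => hnn _ _) (fun _ _ => hsymm _ _) _))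

lemma exists_isTree_graphCost_eq_mstCost (c : V → V → ℝ) {R : Finset V} (hR : R.Nonempty) :
    ∃ T : SimpleGraph {v : V // v ∈ R}, T.IsTree ∧
      graphCost (fun a b => c a.1 b.1) T = mstCost c R := by
  have : Nonempty {v : V // v ∈ R} := hR.to_subtype
  obtain ⟨T, -, hT⟩ :=
    (SimpleGraph.connected_top (V := {v : V // v ∈ R})).exists_isTree_le
  have hfin : {x : ℝ | ∃ T : SimpleGraph {v : V // v ∈ R},
      T.IsTree ∧ graphCost (fun a b => c a.1 b.1) T = x}.Finite :=
    (Set.finite_range fun T : SimpleGraph {v : V // v ∈ R} =>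
      graphCost (fun a b => c a.1 b.1) T).subset fun x ⟨T, _, hx⟩ => ⟨T, hx⟩
  exact Set.Nonempty.csInf_mem (s := {x : ℝ | ∃ T : SimpleGraph {v : V // v ∈ R},
    T.IsTree ∧ graphCost (fun a b => c a.1 b.1) T = x}) ⟨_, T, hT, rfl⟩ hfin

/-- The minimum spanning tree of a set of at least two vertices costs at most twice as much as
any connected graph whose vertices include this set. -/
lemma mstCost_le_two_mul_graphCost {α : Type*} [Fintype α] (hnn : ∀ u v, 0 ≤ c u v)
    (hsymm : ∀ u v, c u v = c v u) (htri : ∀ u v w, c u w ≤ c u v + c v w) {f : α → V}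
    (hf : Function.Injective f) {R : Finset V} (hR : ∀ x ∈ R, ∃ a, f a = x)
    (hcard : ∃ u v, u ≠ v ∧ u ∈ R ∧ v ∈ R) {G : SimpleGraph α} (hG : G.Connected) :
    mstCost c R ≤ 2 * graphCost (fun a b => c (f a) (f b)) G := by
  obtain ⟨_, _, huv, hu, hv⟩ := hcard
  obtain ⟨u, rfl⟩ := hR _ hu
  obtain ⟨v, rfl⟩ := hR _ hv
  obtain ⟨M, hnd, hmem, hM⟩ := exists_hamiltonian_path (c := fun a b => c (f a) (f b))
    (fun _ _ => hnn _ _) (fun _ _ => hsymm _ _) (fun _ _ _ => htri _ _ _) hG (u := u) (v := v)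
    fun h => huv (congrArg f h)
  let t := ((M ++ [v]).map f).filter (· ∈ R)
  have hfilter : ((u :: (M ++ [v])).map f).filter (· ∈ R) = f u :: t := by
    rw [List.map_cons, List.filter_cons_of_pos (by simpa using hu)]
  have hle : mstCost c R ≤ pathCost c (f u :: t) := by
    refine mstCost_le_pathCost hnn hsymm (List.cons_ne_nil _ _) ?_ fun x => ?_
    · rw [← hfilter]
      exact (hnd.map hf).filter _
    · rw [← hfilter, List.mem_filter]
      refine ⟨fun h => by simpa using h.2, fun h => ⟨?_, by simpa using h⟩⟩
      obtain ⟨a, rfl⟩ := hR x h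
      exact List.mem_map_of_mem (hmem a)
  have hsub : pathCost c (f u :: t) ≤ pathCost c ((u :: (M ++ [v])).map f) :=
    pathCost_cons_le_of_sublist hnn htri List.filter_sublist (f u)
  rw [pathCost_map] at hsub
  linarith [hnn (f u) (f v)]

lemma exists_cost_eq_contractedCost (hsymm : ∀ u v, c u v = c v u) (hne : ∀ i, (P i).Nonempty)
    (hdisj : ∀ i j, i ≠ j → Disjoint (P i) (P j)) {w w'} (hw : w ≠ w') :
    ∃ x y, clusterMap P x = w ∧ clusterMap P y = w' ∧ c x y = contractedCost c P w w' := by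
  have hmin : ∀ (x : V) i, ∃ u ∈ P i, c u x = sInf ((fun u => c u x) '' (P i : Set V)) := by
    intro x i
    obtain ⟨u, hu, h⟩ := ((hne i).to_set.image fun u => c u x).csInf_mem (Set.toFinite _)
    exact ⟨u, hu, h⟩
  rcases w with x | i <;> rcases w' with y | j
  · exact ⟨x, y, clusterMap_inl x, clusterMap_inl y, rfl⟩
  · obtain ⟨u, hu, h⟩ := hmin x j
    exact ⟨x, u, clusterMap_inl x, (clusterMap_eq_inr_iff hdisj).2 hu, (hsymm _ _).trans h⟩
  · obtain ⟨u, hu, h⟩ := hmin y i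
    exact ⟨u, y, (clusterMap_eq_inr_iff hdisj).2 hu, clusterMap_inl y, h⟩
  · have hij : i ≠ j := fun h => hw (h ▸ rfl)
    obtain ⟨⟨u, v⟩, huv, h⟩ := (((hne i).to_set.prod (hne j).to_set).image
      fun p : V × V => c p.1 p.2).csInf_mem (Set.toFinite _)
    refine ⟨u, v, (clusterMap_eq_inr_iff hdisj).2 huv.1, (clusterMap_eq_inr_iff hdisj).2 huv.2, ?_⟩
    simp only [contractedCost, if_neg hij]
    exact h

lemma contractedCost_le (hsymm : ∀ u v, c u v = c v u)
    (hdisj : ∀ i j, i ≠ j → Disjoint (P i) (P j)) {x y : V}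
    (hxy : clusterMap P x ≠ clusterMap P y) :
    contractedCost c P (clusterMap P x) (clusterMap P y) ≤ c x y := by
  rcases hx : clusterMap P x with x' | i <;> rcases hy : clusterMap P y with y' | j
  · rw [clusterMap_eq_inl_iff] at hx hy
    rw [hx, hy]
    rfl
  · rw [clusterMap_eq_inl_iff] at hx
    rw [clusterMap_eq_inr_iff hdisj] at hy
    rw [hx, hsymm]
    exact csInf_le (Set.toFinite _).bddBelow ⟨y, hy, rfl⟩
  · rw [clusterMap_eq_inl_iff] at hy
    rw [clusterMap_eq_inr_iff hdisj] at hx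
    rw [hy]
    exact csInf_le (Set.toFinite _).bddBelow ⟨x, hx, rfl⟩
  · have hij : i ≠ j := by
      rintro rfl
      exact hxy (hx.trans hy.symm)
    rw [clusterMap_eq_inr_iff hdisj] at hx hy
    simp only [contractedCost, if_neg hij]
    exact csInf_le (Set.toFinite _).bddBelow ⟨(x, y), ⟨hx, hy⟩, rfl⟩

lemma ClusteredSteinerTree.nonempty_index (T : ClusteredSteinerTree P) : Nonempty (Fin k) := by
  obtain ⟨x⟩ := T.isTree.connected.nonempty
  exact ⟨(T.part_cover x.1 x.2).choose⟩

/-- Contracting the clusters of a clustered Steiner tree yields a Steiner tree for the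
contracted terminals. -/
lemma steinerCost_le_cost (hnn : ∀ u v, 0 ≤ c u v) (hsymm : ∀ u v, c u v = c v u)
    (hne : ∀ i, (P i).Nonempty) (hdisj : ∀ i j, i ≠ j → Disjoint (P i) (P j))
    (T : ClusteredSteinerTree P) {X : Finset ({x : V // ∀ i, x ∉ P i} ⊕ Fin k)}
    (hX : ∀ w ∈ X, ∃ i, w = Sum.inr i) :
    steinerCost (contractedCost c P) X ≤ T.cost c := by
  let S : Finset ({x : V // ∀ i, x ∉ P i} ⊕ Fin k) := T.verts.image (clusterMap P)
  let f : {x : V // x ∈ T.verts} → {w // w ∈ S} :=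
    fun x => ⟨clusterMap P x.1, Finset.mem_image_of_mem _ x.2⟩
  have hf : Function.Surjective f := by
    rintro ⟨w, hw⟩
    obtain ⟨x, hx, rfl⟩ := Finset.mem_image.1 hw
    exact ⟨⟨x, hx⟩, rfl⟩
  obtain ⟨T', hT', hcost⟩ := exists_isTree_graphCost_le hf
    (c := fun a b => c a.1 b.1) (d := fun a b => contractedCost c P a.1 b.1)
    (fun _ _ => hnn _ _) (fun _ _ => contractedCost_nonneg_s12 hnn _ _) T.isTree.connected
    (fun x y _ hxy => contractedCost_le hsymm hdisj fun h => hxy (Subtype.ext h))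
  refine (csInf_le (s := {x : ℝ | ∃ (S : Finset ({x : V // ∀ i, x ∉ P i} ⊕ Fin k))
    (T : SimpleGraph {w // w ∈ S}), X ⊆ S ∧ T.IsTree ∧
      graphCost (fun a b => contractedCost c P a.1 b.1) T = x})
    ⟨0, ?_⟩ ⟨S, T', fun w hw => ?_, hT', rfl⟩).trans hcost
  · rintro _ ⟨S, T, -, -, rfl⟩
    exact graphCost_nonneg_s12 (fun _ _ => contractedCost_nonneg_s12 hnn _ _) T
  · obtain ⟨i, rfl⟩ := hX w hw
    obtain ⟨u, hu⟩ := hne i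
    exact Finset.mem_image.2 ⟨u, T.part_subset i (T.cluster_subset i hu),
      (clusterMap_eq_inr_iff hdisj).2 hu⟩

lemma sum_mstCost_le_cost (hnn : ∀ u v, 0 ≤ c u v) (hsymm : ∀ u v, c u v = c v u)
    (htri : ∀ u v w, c u w ≤ c u v + c v w)
    (hcard : ∀ i, ∃ u v, u ≠ v ∧ u ∈ P i ∧ v ∈ P i) (T : ClusteredSteinerTree P) :
    ∑ i, 2 * mstCost c (P i) ≤ 4 * T.cost c := by
  let A : Fin k → Set {x : V // x ∈ T.verts} := fun i => {x | x.1 ∈ T.part i}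
  have hA : ∀ i j, i ≠ j → Disjoint (A i) (A j) := fun i j hij =>
    Set.disjoint_left.2 fun x hi hj => Finset.disjoint_left.1 (T.part_disjoint i j hij) hi hj
  have hmst : ∀ i, mstCost c (P i) ≤
      2 * graphCost (fun x y : A i => c x.1.1 y.1.1) (T.tree.induce (A i)) := fun i =>
    mstCost_le_two_mul_graphCost hnn hsymm htri
      (Subtype.val_injective.comp Subtype.val_injective)
      (fun x hx => ⟨⟨⟨x, T.part_subset i (T.cluster_subset i hx)⟩, T.cluster_subset i hx⟩, rfl⟩)
      (hcard i) (T.part_connected i)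
  have hsum := sum_graphCost_induce_le (c := fun x y : {x : V // x ∈ T.verts} => c x.1 y.1)
    (fun _ _ => hnn _ _) T.tree A hA
  calc ∑ i, 2 * mstCost c (P i)
      ≤ ∑ i, 4 * graphCost (fun x y : A i => c x.1.1 y.1.1) (T.tree.induce (A i)) :=
        Finset.sum_le_sum fun i _ => by linarith [hmst i]
    _ ≤ 4 * T.cost c := by
        rw [← Finset.mul_sum]
        exact mul_le_mul_of_nonneg_left hsum (by norm_num)

/-- A Steiner tree of the contracted graph can be expanded to a clustered selected-internal
Steiner tree by replacing every contracted cluster with a Hamiltonian path of the cluster. -/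
theorem exists_selectedInternal_cost_le (hnn : ∀ u v, 0 ≤ c u v)
    (hsymm : ∀ u v, c u v = c v u) (htri : ∀ u v w, c u w ≤ c u v + c v w) [Nonempty (Fin k)]
    {P' : Fin k → Finset V} (hdisj : ∀ i j, i ≠ j → Disjoint (P i) (P j))
    (hP' : ∀ i, P' i ⊆ P i)
    (hcard : ∀ i, ∃ u v, u ≠ v ∧ (u ∈ P i ∧ u ∉ P' i) ∧ v ∈ P i ∧ v ∉ P' i)
    {Sverts : Finset ({x : V // ∀ i, x ∉ P i} ⊕ Fin k)} {S : SimpleGraph {w // w ∈ Sverts}}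
    (hS : S.IsTree) (hterm : ∀ i, Sum.inr i ∈ Sverts) :
    ∃ T : ClusteredSteinerTree P, T.SelectedInternal P' ∧
      T.cost c ≤ (∑ i, 2 * mstCost c (P i)) +
        graphCost (fun a b => contractedCost c P a.1 b.1) S := by
  have hne : ∀ i, (P i).Nonempty := fun i => by
    obtain ⟨u, _, _, hu, _⟩ := hcard i
    exact ⟨u, hu.1⟩
  let verts : Finset V := Finset.univ.filter fun v => clusterMap P v ∈ Sverts
  have hverts : ∀ v, v ∈ verts ↔ clusterMap P v ∈ Sverts := fun v => by simp [verts]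
  have hPv : ∀ {i v}, v ∈ P i → v ∈ verts := fun {i v} hv => by
    rw [hverts, (clusterMap_eq_inr_iff hdisj).2 hv]
    exact hterm i
  let f : {v // v ∈ verts} → {w // w ∈ Sverts} := fun v => ⟨clusterMap P v.1, (hverts _).1 v.2⟩
  have hL : ∀ w : {w // w ∈ Sverts}, ∃ l : List {v // v ∈ verts}, l ≠ [] ∧ l.Nodup ∧
      (∀ x, x ∈ l ↔ f x = w) ∧
      pathCost (fun a b => c a.1 b.1) l ≤
        Sum.elim (fun _ => 0) (fun i => 2 * mstCost c (P i)) w.1 ∧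
      ∀ i, w.1 = Sum.inr i → ∀ x, x.1 ∈ P' i →
        ∃ y z, y ≠ z ∧ (y, x) ∈ consecutivePairs l ∧ (x, z) ∈ consecutivePairs l := by
    rintro ⟨x | i, hw⟩
    · have hx : x.1 ∈ verts := by rwa [hverts, clusterMap_inl]
      refine ⟨[⟨x.1, hx⟩], by simp, by simp, fun y => ?_, by simp, by simp⟩
      simp [f, clusterMap_eq_inl_iff, Subtype.ext_iff]
    · obtain ⟨T, hT, hTc⟩ := exists_isTree_graphCost_eq_mstCost c (hne i)
      obtain ⟨u, v, huv, hu, hv⟩ := hcard i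
      obtain ⟨M, hnd, hmem, hM⟩ := exists_hamiltonian_path
        (c := fun a b : {v // v ∈ P i} => c a.1 b.1)
        (fun _ _ => hnn _ _) (fun _ _ => hsymm _ _) (fun _ _ _ => htri _ _ _) hT.connected
        (u := ⟨u, hu.1⟩) (v := ⟨v, hv.1⟩) (by simpa using huv)
      let e : {v // v ∈ P i} → {v // v ∈ verts} := fun v => ⟨v.1, hPv v.2⟩
      have he : Function.Injective e := fun a b h =>
        Subtype.ext (congrArg (fun x : {v // v ∈ verts} => x.1) h)
      refine ⟨(⟨u, hu.1⟩ :: (M ++ [⟨v, hv.1⟩])).map e, by simp, hnd.map he, fun x => ?_, ?_, ?_⟩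
      · rw [List.mem_map, Subtype.ext_iff]
        refine ⟨?_, fun h => ⟨⟨x.1, (clusterMap_eq_inr_iff hdisj).1 h⟩, hmem _, rfl⟩⟩
        rintro ⟨a, -, rfl⟩
        exact (clusterMap_eq_inr_iff hdisj).2 a.2
      · rw [pathCost_map]
        simp only [Sum.elim_inr]
        have := hnn u v
        simp only [e]
        linarith
      · intro j hj x hx
        obtain rfl : i = j := Sum.inr_injective hj
        have hxM : (⟨x.1, hP' i hx⟩ : {v // v ∈ P i}) ∈ M := by
          have h := hmem ⟨x.1, hP' i hx⟩
          rcases List.mem_cons.1 h with h | h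
          · have hxu : x.1 = u := congrArg (fun y : {v // v ∈ P i} => y.1) h
            exact absurd hx (hxu ▸ hu.2)
          · rcases List.mem_append.1 h with h | h
            · exact h
            · have hxv : x.1 = v :=
                congrArg (fun y : {v // v ∈ P i} => y.1) (List.mem_singleton.1 h)
              exact absurd hx (hxv ▸ hv.2)
        obtain ⟨y, z, hyz, h₁, h₂⟩ := exists_consecutivePairs_of_mem _ _ M _ hnd hxM
        rw [consecutivePairs_map]
        exact ⟨e y, e z, he.ne hyz, List.mem_map_of_mem (f := Prod.map e e) h₁,
          List.mem_map_of_mem (f := Prod.map e e) h₂⟩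
  choose L hLne hLnd hLmem hLcost hLint using hL
  obtain ⟨G, hG, hGL, hGcost⟩ := exists_isTree_blowup
    (c := fun a b : {v // v ∈ verts} => c a.1 b.1)
    (d := fun a b : {w // w ∈ Sverts} => contractedCost c P a.1 b.1)
    (fun _ _ => hnn _ _) (fun _ _ => hsymm _ _) (fun _ _ => contractedCost_symm hsymm _ _)
    f L hLne hLnd hLmem (fun w w' hw => by
      obtain ⟨x, y, hx, hy, h⟩ := exists_cost_eq_contractedCost (c := c) hsymm hne hdisj
        fun h => hw (Subtype.ext h)
      exact ⟨⟨x, (hverts x).2 (hx ▸ w.2)⟩, ⟨y, (hverts y).2 (hy ▸ w'.2)⟩, Subtype.ext hx,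
        Subtype.ext hy, h.le⟩) hS
  let A : Fin k → Set {v // v ∈ verts} := fun i => {x | x.1 ∈ P i}
  obtain ⟨B, hAB, hBcover, hBdisj, hBconn⟩ := exists_connected_partition hG.connected A
    (fun i => connected_induce_of_consecutivePairs (hLne ⟨_, hterm i⟩) (fun x => by
      rw [hLmem, Subtype.ext_iff]
      exact clusterMap_eq_inr_iff hdisj) (hGL _))
    (fun i j hij => Set.disjoint_left.2 fun x hi hj =>
      Finset.disjoint_left.1 (hdisj i j hij) hi hj)
  let part : Fin k → Finset V := fun i => Finset.univ.filter fun v => ∃ h : v ∈ verts, ⟨v, h⟩ ∈ B i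
  have hpart : ∀ i v, v ∈ part i ↔ ∃ h : v ∈ verts, ⟨v, h⟩ ∈ B i := fun i v => by simp [part]
  have hpart' : ∀ i (x : {v // v ∈ verts}), x.1 ∈ part i ↔ x ∈ B i := fun i x =>
    (hpart i x.1).trans ⟨fun ⟨_, h⟩ => h, fun h => ⟨x.2, h⟩⟩
  let T : ClusteredSteinerTree P :=
    { verts := verts
      tree := G
      isTree := hG
      part := part
      part_subset := fun i v hv => ((hpart i v).1 hv).choose
      cluster_subset := fun i v hv => (hpart i v).2 ⟨hPv hv, hAB i hv⟩
      part_cover := fun v hv => by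
        obtain ⟨i, hi⟩ := hBcover ⟨v, hv⟩
        exact ⟨i, (hpart i v).2 ⟨hv, hi⟩⟩
      part_disjoint := fun i j hij => Finset.disjoint_left.2 fun v hi hj => by
        obtain ⟨h, hi⟩ := (hpart i v).1 hi
        obtain ⟨_, hj⟩ := (hpart j v).1 hj
        exact Set.disjoint_left.1 (hBdisj i j hij) hi hj
      part_connected := fun i => by
        have : {x : {v // v ∈ verts} | x.1 ∈ part i} = B i := Set.ext fun x => hpart' i x
        rw [this]
        exact hBconn i }
  refine ⟨T, fun i x hx => ?_, hGcost.trans (add_le_add_left ?_ _)⟩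
  · have hxv := hPv (hP' i hx)
    obtain ⟨y, z, hyz, h₁, h₂⟩ := hLint ⟨_, hterm i⟩ i rfl ⟨x, hxv⟩ hx
    have hmem : ∀ y ∈ L ⟨_, hterm i⟩, y.1 ∈ part i := fun y hy =>
      (hpart' i y).2 (hAB i ((clusterMap_eq_inr_iff hdisj).1
        (congrArg Subtype.val ((hLmem _ y).1 hy))))
    exact ⟨hxv, y, z, hmem y (mem_of_mem_consecutivePairs h₁).1,
      hmem z (mem_of_mem_consecutivePairs h₂).2, hyz, (hGL _ _ h₁).symm, hGL _ _ h₂⟩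
  · have hmst : ∀ i, 0 ≤ mstCost c (P i) := fun i => Real.sInf_nonneg (by
      rintro _ ⟨T, -, rfl⟩
      exact graphCost_nonneg_s12 (fun _ _ => hnn _ _) T)
    calc ∑ w, pathCost (fun a b => c a.1 b.1) (L w)
        ≤ ∑ w : {w // w ∈ Sverts},
            Sum.elim (fun _ => 0) (fun i => 2 * mstCost c (P i)) w.1 :=
          Finset.sum_le_sum fun w _ => hLcost w
      _ = ∑ w ∈ Sverts, Sum.elim (fun _ => 0) (fun i => 2 * mstCost c (P i)) w :=
          Finset.sum_coe_sort Sverts (Sum.elim (fun _ => 0) fun i => 2 * mstCost c (P i))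
      _ ≤ ∑ w, Sum.elim (fun _ => 0) (fun i => 2 * mstCost c (P i)) w := by
          refine Finset.sum_le_univ_sum_of_nonneg fun w => ?_
          rcases w with x | i
          · exact le_rfl
          · exact mul_nonneg zero_le_two (hmst i)
      _ = ∑ i, 2 * mstCost c (P i) := by simp [Fintype.sum_sum_type]

end Clusters

/-- Theorem 1 (performance guarantee): given a minimum-cost clustered
selected-internal Steiner tree `Topt` and any `ρ`-approximate Steiner tree
`Stree` for the contracted terminals in `G/R`, there is a clustered
selected-internal Steiner tree `𝒯` with
`c(𝒯) ≤ ∑ i, 2·mst(P i) + c(Stree)` and `c(𝒯) ≤ (ρ + 4) · c(Topt)`. -/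
theorem apx_performance_guarantee {V : Type*} [Fintype V] [DecidableEq V]
    (c : V → V → ℝ)
    (hnn : ∀ u v, 0 ≤ c u v) (hsymm : ∀ u v, c u v = c v u)
    (hrefl : ∀ v, c v v = 0) (htri : ∀ u v w, c u w ≤ c u v + c v w)
    {k : ℕ} (P P' : Fin k → Finset V)
    (hne : ∀ i, (P i).Nonempty)
    (hdisj : ∀ i j, i ≠ j → Disjoint (P i) (P j))
    (hproper : ∃ x : V, ∀ i, x ∉ P i)
    (hP' : ∀ i, P' i ⊆ P i)
    (hcard : ∀ i, 2 ≤ ((P i) \ (P' i)).card)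
    (ρ : ℝ) (hρ : 1 ≤ ρ)
    (Topt : ClusteredSteinerTree P) (hTopt : Topt.SelectedInternal P')
    (hTopt_min : ∀ T' : ClusteredSteinerTree P, T'.SelectedInternal P' →
      Topt.cost c ≤ T'.cost c)
    (Sverts : Finset ({x : V // ∀ i, x ∉ P i} ⊕ Fin k))
    (Stree : SimpleGraph {w : {x : V // ∀ i, x ∉ P i} ⊕ Fin k // w ∈ Sverts})
    (hStree : Stree.IsTree)
    (hSterm : Finset.univ.image Sum.inr ⊆ Sverts)
    (hSρ : graphCost (fun a b => contractedCost c P a.1 b.1) Stree ≤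
      ρ * steinerCost (contractedCost c P) (Finset.univ.image Sum.inr)) :
    ∃ T : ClusteredSteinerTree P, T.SelectedInternal P' ∧
      T.cost c ≤ (∑ i : Fin k, 2 * mstCost c (P i)) +
        graphCost (fun a b => contractedCost c P a.1 b.1) Stree ∧
      T.cost c ≤ (ρ + 4) * Topt.cost c := by
  have hcard' : ∀ i, ∃ u v, u ≠ v ∧ (u ∈ P i ∧ u ∉ P' i) ∧ v ∈ P i ∧ v ∉ P' i := fun i => by
    obtain ⟨u, hu, v, hv, huv⟩ := Finset.one_lt_card.1 (hcard i)
    exact ⟨u, v, huv, Finset.mem_sdiff.1 hu, Finset.mem_sdiff.1 hv⟩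
  have := Topt.nonempty_index
  obtain ⟨T, hT, hcost⟩ := exists_selectedInternal_cost_le hnn hsymm htri hdisj hP' hcard' hStree
    fun i => hSterm (Finset.mem_image_of_mem _ (Finset.mem_univ i))
  refine ⟨T, hT, hcost, hcost.trans ?_⟩
  have h₁ := sum_mstCost_le_cost hnn hsymm htri
    (fun i => (hcard' i).imp fun u => Exists.imp fun v h => ⟨h.1, h.2.1.1, h.2.2.1⟩) Topt
  have h₂ := steinerCost_le_cost (P := P) hnn hsymm hne hdisj Topt
    (X := Finset.univ.image Sum.inr) fun w hw => by
      obtain ⟨i, -, h⟩ := Finset.mem_image.1 hw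
      exact ⟨i, h.symm⟩
  have h₃ := mul_le_mul_of_nonneg_left h₂ (zero_le_one.trans hρ)
  linarith [hSρ.trans h₃]
end
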